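/- arXiv:1307.1297 — 2 statements merged into one kernel-verified Lean document; each statement's English description precedes it below -/
import Mathlib

section
/- Let I be a compact interval of ℝ, let f: I → I be an interval map of class C^3 with non-flat critical points that is topologically exact, and let φ: I → ℝ be a continuous function. Then for every point x₀ of I we have P(f, φ) ≥ limsup_{n→∞} (1/n) log Σ_{y ∈ f^{−n}(x₀)} exp(S_n(φ)(y)). -/
open MeasureTheory Filter Set Metric

noncomputable section

/-- Shannon entropy of the law of a finitely-valued map `p` under the measure `μ`. -/
def partitionEntropy {X ι : Type*} [MeasurableSpace X] [Fintype ι]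
    (μ : Measure X) (p : X → ι) : ℝ :=
  ∑ i, Real.negMulLog (μ (p ⁻¹' {i})).toReal

/-- Kolmogorov–Sinai (measure-theoretic) entropy of `f` with respect to `μ`:
the supremum over finite measurable partitions (coded by maps into `Fin k`) of the
limit (here: infimum, by subadditivity) of the normalized entropies of the joins. -/
def ksEntropy {X : Type*} [MeasurableSpace X] (μ : Measure X) (f : X → X) : ℝ :=
  ⨆ k : ℕ, ⨆ p : { p : X → Fin k // Measurable p },
    ⨅ n : ℕ, partitionEntropy μ (fun x (i : Fin (n + 1)) => p.1 (f^[(i : ℕ)] x)) / (n + 1)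

/-- `μ` is an `f`-invariant Borel probability measure giving full mass to `I`. -/
def InvariantProb (f : ℝ → ℝ) (I : Set ℝ) (μ : Measure ℝ) : Prop :=
  IsProbabilityMeasure μ ∧ μ I = 1 ∧ ∀ A : Set ℝ, MeasurableSet A → μ (f ⁻¹' A) = μ A

/-- Topological pressure of `f : I → I` for the potential `φ`, defined via the
variational principle. -/
def pressure (f : ℝ → ℝ) (I : Set ℝ) (φ : ℝ → ℝ) : ℝ :=
  sSup { r : ℝ | ∃ μ : Measure ℝ, InvariantProb f I μ ∧ r = ksEntropy μ f + ∫ x, φ x ∂μ }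

/-- An equilibrium state of `f` for the potential `φ`. -/
def IsEquilibriumState (f : ℝ → ℝ) (I : Set ℝ) (φ : ℝ → ℝ) (μ : Measure ℝ) : Prop :=
  InvariantProb f I μ ∧ ksEntropy μ f + ∫ x, φ x ∂μ = pressure f I φ

/-- `φ` is Hölder continuous on `I`. -/
def HolderOn (φ : ℝ → ℝ) (I : Set ℝ) : Prop :=
  ∃ C α : ℝ, 0 < α ∧ α ≤ 1 ∧ 0 ≤ C ∧ ∀ x ∈ I, ∀ y ∈ I, |φ x - φ y| ≤ C * |x - y| ^ α

/-- `φ` is hyperbolic for `f`: for some `n ≥ 1`, `sup_I (1/n) Sₙ(φ) < P(f, φ)`. -/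
def HyperbolicPotential (f : ℝ → ℝ) (I : Set ℝ) (φ : ℝ → ℝ) : Prop :=
  ∃ n : ℕ, 1 ≤ n ∧ sSup ((fun x => birkhoffSum f φ n x / n) '' I) < pressure f I φ

/-- `g` is a `C³` diffeomorphism of `ℝ`. -/
def IsC3Diffeo (g : ℝ → ℝ) : Prop :=
  ContDiff ℝ 3 g ∧ Function.Bijective g ∧ ∀ x, deriv g x ≠ 0

/-- `f` is an interval map of class `C³` with non-flat critical points on `I = [a, b]`. -/
structure IsC3NonflatIntervalMap (f : ℝ → ℝ) (a b : ℝ) : Prop where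
  lt : a < b
  mapsTo : MapsTo f (Icc a b) (Icc a b)
  diff : ∀ x ∈ Icc a b, DifferentiableAt ℝ f x
  critFinite : {x | x ∈ Icc a b ∧ deriv f x = 0}.Finite
  smooth : ContDiffOn ℝ 3 f ((Icc a b) \ {x | deriv f x = 0})
  nonflat : ∀ c ∈ Icc a b, deriv f c = 0 →
    ∃ ℓ : ℝ, 1 < ℓ ∧ ∃ φ ψ : ℝ → ℝ, IsC3Diffeo φ ∧ IsC3Diffeo ψ ∧
      φ c = 0 ∧ ψ (f c) = 0 ∧
      ∀ᶠ x in nhdsWithin c (Icc a b), |ψ (f x)| = |φ x| ^ ℓ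

/-- `f : I → I` is topologically exact. -/
def TopExact (f : ℝ → ℝ) (I : Set ℝ) : Prop :=
  ∀ U : Set ℝ, IsOpen U → (U ∩ I).Nonempty → ∃ n : ℕ, 1 ≤ n ∧ f^[n] '' (U ∩ I) = I

/-- `Σ_{y ∈ f^{-n}(x₀) ∩ I} exp(Sₙ(φ)(y))`, as a finite sum (`finsum`);
for interval maps in our class each preimage set is finite. -/
def preimSum (f φ : ℝ → ℝ) (I : Set ℝ) (n : ℕ) (x₀ : ℝ) : ℝ :=
  ∑ᶠ y ∈ {y | y ∈ I ∧ f^[n] y = x₀}, Real.exp (birkhoffSum f φ n y)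

/-- `negMulLog` is subadditive on nonnegative families. -/
lemma negMulLog_sum_le {ι : Type*} (s : Finset ι) (w : ι → ℝ) (hw : ∀ i ∈ s, 0 ≤ w i) :
    Real.negMulLog (∑ i ∈ s, w i) ≤ ∑ i ∈ s, Real.negMulLog (w i) := by
  have h : Real.negMulLog (∑ i ∈ s, w i) = ∑ i ∈ s, -w i * Real.log (∑ i ∈ s, w i) := by
    rw [Real.negMulLog, ← Finset.sum_mul, Finset.sum_neg_distrib]
  rw [h]
  refine Finset.sum_le_sum fun i hi => ?_
  rcases (hw i hi).eq_or_lt with h0 | h0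
  · simp [← h0]
  · have h1 : Real.log (w i) ≤ Real.log (∑ i ∈ s, w i) :=
      Real.log_le_log h0 (Finset.single_le_sum hw hi)
    rw [Real.negMulLog]
    nlinarith

/-- A finite family with at most `M` members has entropy at most `log M` times its mass, plus
the entropy of its mass. -/
lemma sum_negMulLog_le {ι : Type*} (s : Finset ι) (w : ι → ℝ) (hw : ∀ i ∈ s, 0 ≤ w i)
    {M : ℕ} (hM : 1 ≤ M) (hs : s.card ≤ M) :
    ∑ i ∈ s, Real.negMulLog (w i) ≤
      Real.negMulLog (∑ i ∈ s, w i) + (∑ i ∈ s, w i) * Real.log M := by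
  set W := ∑ i ∈ s, w i with hW
  have hMpos : (0 : ℝ) < M := by exact_mod_cast hM
  have hW0 : 0 ≤ W := Finset.sum_nonneg hw
  have key : ∀ i ∈ s, Real.negMulLog (w i) ≤
      -w i * Real.log W + w i * Real.log M + (W / M - w i) := by
    intro i hi
    rcases (hw i hi).eq_or_lt with h0 | h0
    · simp only [← h0, Real.negMulLog_zero]
      have : 0 ≤ W / M := by positivity
      linarith
    · have hWpos : 0 < W := lt_of_lt_of_le h0 (Finset.single_le_sum hw hi)
      have h1 := Real.log_le_sub_one_of_pos (x := W / (M * w i)) (by positivity)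
      rw [Real.log_div hWpos.ne' (by positivity), Real.log_mul hMpos.ne' h0.ne'] at h1
      have h2 := mul_le_mul_of_nonneg_left h1 h0.le
      have h3 : w i * (W / (M * w i) - 1) = W / M - w i := by field_simp
      rw [h3] at h2
      rw [Real.negMulLog]
      linarith
  refine (Finset.sum_le_sum key).trans ?_
  rw [Finset.sum_add_distrib, Finset.sum_add_distrib, ← Finset.sum_mul, ← Finset.sum_mul,
    Finset.sum_sub_distrib, Finset.sum_neg_distrib, ← hW, Finset.sum_const, nsmul_eq_mul,
    Real.negMulLog]
  have : (s.card : ℝ) * (W / M) ≤ W := by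
    rw [← mul_div_assoc, div_le_iff₀ hMpos, mul_comm]
    exact mul_le_mul_of_nonneg_left (by exact_mod_cast hs) hW0
  linarith

/-- Subadditivity of the entropy of a finite joint distribution. -/
lemma sum_negMulLog_prod_le {ι κ : Type*} [Fintype ι] [Fintype κ] (w : ι → κ → ℝ)
    (hw : ∀ i j, 0 ≤ w i j) (h1 : ∑ i, ∑ j, w i j = 1) :
    ∑ i, ∑ j, Real.negMulLog (w i j) ≤
      ∑ i, Real.negMulLog (∑ j, w i j) + ∑ j, Real.negMulLog (∑ i, w i j) := by
  set A : ι → ℝ := fun i => ∑ j, w i j with hA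
  set B : κ → ℝ := fun j => ∑ i, w i j with hB
  have hB1 : ∑ j, B j = 1 := by rw [← h1, Finset.sum_comm]
  have hA0 : ∀ i, 0 ≤ A i := fun i => Finset.sum_nonneg fun j _ => hw i j
  have hB0 : ∀ j, 0 ≤ B j := fun j => Finset.sum_nonneg fun i _ => hw i j
  have key : ∀ i j, Real.negMulLog (w i j) ≤
      -w i j * Real.log (A i) + -w i j * Real.log (B j) + (A i * B j - w i j) := by
    intro i j
    rcases (hw i j).eq_or_lt with h0 | h0
    · simp only [← h0, Real.negMulLog_zero]
      have := mul_nonneg (hA0 i) (hB0 j)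
      linarith
    · have hAi : 0 < A i := lt_of_lt_of_le h0
        (Finset.single_le_sum (f := fun j => w i j) (fun j _ => hw i j) (Finset.mem_univ j))
      have hBj : 0 < B j := lt_of_lt_of_le h0
        (Finset.single_le_sum (f := fun i => w i j) (fun i _ => hw i j) (Finset.mem_univ i))
      have h1 := Real.log_le_sub_one_of_pos (x := A i * B j / w i j) (by positivity)
      rw [Real.log_div (by positivity) h0.ne', Real.log_mul hAi.ne' hBj.ne'] at h1
      have h2 := mul_le_mul_of_nonneg_left h1 h0.le
      have h3 : w i j * (A i * B j / w i j - 1) = A i * B j - w i j := by field_simp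
      rw [h3] at h2
      rw [Real.negMulLog]
      linarith
  refine (Finset.sum_le_sum fun i _ => Finset.sum_le_sum fun j _ => key i j).trans ?_
  have e1 : ∑ i, ∑ j, -w i j * Real.log (A i) = ∑ i, Real.negMulLog (A i) := by
    refine Finset.sum_congr rfl fun i _ => ?_
    rw [← Finset.sum_mul, Finset.sum_neg_distrib, Real.negMulLog]
  have e2 : ∑ i, ∑ j, -w i j * Real.log (B j) = ∑ j, Real.negMulLog (B j) := by
    rw [Finset.sum_comm]
    refine Finset.sum_congr rfl fun j _ => ?_
    rw [← Finset.sum_mul, Finset.sum_neg_distrib, Real.negMulLog]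
  have e3 : ∑ i, ∑ j, A i * B j = 1 := by
    simp_rw [← Finset.mul_sum, hB1, mul_one]
    exact h1
  simp_rw [Finset.sum_add_distrib, Finset.sum_sub_distrib]
  rw [e1, e2, e3, h1]
  linarith

section Entropy

variable {X : Type*} [MeasurableSpace X]

lemma partitionEntropy_nonneg {ι : Type*} [Fintype ι] (μ : Measure X) [IsProbabilityMeasure μ]
    (p : X → ι) : 0 ≤ partitionEntropy μ p :=
  Finset.sum_nonneg fun _ _ => Real.negMulLog_nonneg ENNReal.toReal_nonneg measureReal_le_one

lemma partitionEntropy_congr {ι : Type*} [Fintype ι] {μ ν : Measure X} {p q : X → ι}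
    (h : ∀ i, μ (p ⁻¹' {i}) = ν (q ⁻¹' {i})) :
    partitionEntropy μ p = partitionEntropy ν q := by
  simp only [partitionEntropy, h]

lemma measureReal_preimage_comp {ι κ : Type*} [Fintype ι] [DecidableEq κ] (μ : Measure X)
    [IsFiniteMeasure μ] {p : X → ι} (hp : ∀ i, MeasurableSet (p ⁻¹' {i})) (g : ι → κ) (j : κ) :
    μ.real ((fun x => g (p x)) ⁻¹' {j}) = ∑ i with g i = j, μ.real (p ⁻¹' {i}) := by
  rw [← measureReal_biUnion_finset]
  · congr 1
    ext x
    simp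
  · intro i _ k _ hik
    exact Disjoint.preimage _ (by simpa using hik)
  · exact fun i _ => hp i

lemma partitionEntropy_comp_le {ι κ : Type*} [Fintype ι] [Fintype κ] (μ : Measure X)
    [IsFiniteMeasure μ] {p : X → ι} (hp : ∀ i, MeasurableSet (p ⁻¹' {i})) (g : ι → κ) :
    partitionEntropy μ (fun x => g (p x)) ≤ partitionEntropy μ p := by
  classical
  unfold partitionEntropy
  rw [← Finset.sum_fiberwise Finset.univ g (fun i => Real.negMulLog (μ (p ⁻¹' {i})).toReal)]
  refine Finset.sum_le_sum fun j _ => ?_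
  have := measureReal_preimage_comp μ hp g j
  rw [Measure.real] at this
  rw [this]
  exact negMulLog_sum_le _ _ fun i _ => measureReal_nonneg

lemma sum_measureReal_preimage_eq_one {ι : Type*} [Fintype ι] (μ : Measure X)
    [IsProbabilityMeasure μ] {p : X → ι} (hp : ∀ i, MeasurableSet (p ⁻¹' {i})) :
    ∑ i, μ.real (p ⁻¹' {i}) = 1 := by
  have := measureReal_preimage_comp μ hp (fun _ => ()) ()
  simpa using this.symm

lemma partitionEntropy_prod_le {ι κ : Type*} [Fintype ι] [Fintype κ] (μ : Measure X)
    [IsProbabilityMeasure μ] {p : X → ι} {q : X → κ} (hp : ∀ i, MeasurableSet (p ⁻¹' {i}))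
    (hq : ∀ i, MeasurableSet (q ⁻¹' {i})) :
    partitionEntropy μ (fun x => (p x, q x)) ≤ partitionEntropy μ p + partitionEntropy μ q := by
  classical
  have hpq : ∀ i, MeasurableSet ((fun x => (p x, q x)) ⁻¹' {i}) := by
    intro i
    have : (fun x => (p x, q x)) ⁻¹' {i} = p ⁻¹' {i.1} ∩ q ⁻¹' {i.2} := by
      ext x; simp [Prod.ext_iff]
    rw [this]
    exact (hp _).inter (hq _)
  have h1 : ∀ i, μ.real (p ⁻¹' {i}) = ∑ j, μ.real ((fun x => (p x, q x)) ⁻¹' {(i, j)}) := by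
    intro i
    rw [measureReal_preimage_comp μ hpq Prod.fst i, Finset.sum_filter, Fintype.sum_prod_type,
      Finset.sum_eq_single i] <;> simp +contextual
  have h2 : ∀ j, μ.real (q ⁻¹' {j}) = ∑ i, μ.real ((fun x => (p x, q x)) ⁻¹' {(i, j)}) := by
    intro j
    rw [measureReal_preimage_comp μ hpq Prod.snd j, Finset.sum_filter, Fintype.sum_prod_type_right,
      Finset.sum_eq_single j] <;> simp +contextual
  have h3 := sum_negMulLog_prod_le (fun i j => μ.real ((fun x => (p x, q x)) ⁻¹' {(i, j)}))
    (fun _ _ => measureReal_nonneg) (by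
      rw [← sum_measureReal_preimage_eq_one μ hpq, Fintype.sum_prod_type])
  simp only [← h1, ← h2] at h3
  unfold partitionEntropy
  rw [Fintype.sum_prod_type]
  exact h3

/-- A map determined by `p` and `q` has entropy at most the sum of their entropies. -/
lemma partitionEntropy_le_add {ι κ τ : Type*} [Fintype ι] [Fintype κ] [Fintype τ]
    (μ : Measure X) [IsProbabilityMeasure μ] {p : X → ι} {q : X → κ}
    (hp : ∀ i, MeasurableSet (p ⁻¹' {i})) (hq : ∀ i, MeasurableSet (q ⁻¹' {i})) {r : X → τ}
    (G : ι → κ → τ) (h : ∀ x, r x = G (p x) (q x)) :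
    partitionEntropy μ r ≤ partitionEntropy μ p + partitionEntropy μ q := by
  refine le_trans ?_ (partitionEntropy_prod_le μ hp hq)
  have hpq : ∀ i, MeasurableSet ((fun x => (p x, q x)) ⁻¹' {i}) := by
    intro i
    have : (fun x => (p x, q x)) ⁻¹' {i} = p ⁻¹' {i.1} ∩ q ⁻¹' {i.2} := by
      ext x; simp [Prod.ext_iff]
    rw [this]
    exact (hp _).inter (hq _)
  rw [show r = fun x => G (p x) (q x) from funext h]
  exact partitionEntropy_comp_le μ hpq fun s => G s.1 s.2

lemma partitionEntropy_le_log {ι : Type*} [Fintype ι] (μ : Measure X)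
    [IsProbabilityMeasure μ] {p : X → ι} (hp : ∀ i, MeasurableSet (p ⁻¹' {i}))
    (F : Finset ι) (hF : ∀ i ∉ F, μ (p ⁻¹' {i}) = 0) {M : ℕ} (hM : F.card ≤ M) :
    partitionEntropy μ p ≤ Real.log M := by
  have e1 : partitionEntropy μ p = ∑ i ∈ F, Real.negMulLog (μ.real (p ⁻¹' {i})) := by
    refine (Finset.sum_subset (Finset.subset_univ F) fun i _ hi => ?_).symm
    simp [hF i hi]
  have e2 : ∑ i ∈ F, μ.real (p ⁻¹' {i}) = 1 := by
    rw [← sum_measureReal_preimage_eq_one μ hp]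
    refine Finset.sum_subset (Finset.subset_univ F) fun i _ hi => ?_
    simp [Measure.real, hF i hi]
  have hM1 : 1 ≤ M := by
    rcases F.eq_empty_or_nonempty with rfl | h
    · simp at e2
    · exact h.card_pos.trans_le hM
  have := sum_negMulLog_le F (fun i => μ.real (p ⁻¹' {i})) (fun _ _ => measureReal_nonneg) hM1 hM
  rw [e2] at this
  rw [e1]
  simpa using this

lemma partitionEntropy_map {Y ι : Type*} [MeasurableSpace Y] [Fintype ι] (μ : Measure X)
    {T : X → Y} (hT : Measurable T) {p : Y → ι} (hp : ∀ i, MeasurableSet (p ⁻¹' {i})) :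
    partitionEntropy (μ.map T) p = partitionEntropy μ (fun x => p (T x)) := by
  unfold partitionEntropy
  refine Finset.sum_congr rfl fun i _ => ?_
  rw [Measure.map_apply hT (hp i)]
  rfl

/-- The entropy of a finite weighted sum of Dirac masses is at most the entropy of a partition
plus the logarithm of the largest number of atoms in a cell. -/
lemma sum_negMulLog_le_partitionEntropy {ι : Type*} [Fintype ι] (E : Finset X) (w : X → ℝ)
    (hw : ∀ y ∈ E, 0 ≤ w y) (hw1 : ∑ y ∈ E, w y = 1) {p : X → ι}
    (hp : ∀ i, MeasurableSet (p ⁻¹' {i})) {M : ℕ} (hM1 : 1 ≤ M)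
    (hM : ∀ i, ({y ∈ (E : Set X) | p y = i}).encard ≤ M) :
    ∑ y ∈ E, Real.negMulLog (w y) ≤
      partitionEntropy (∑ y ∈ E, ENNReal.ofReal (w y) • Measure.dirac y) p + Real.log M := by
  classical
  have hmass : ∀ i, ((∑ y ∈ E, ENNReal.ofReal (w y) • Measure.dirac y : Measure X)
      (p ⁻¹' {i})).toReal = ∑ y ∈ E with p y = i, w y := by
    intro i
    rw [Measure.finsetSum_apply, ENNReal.toReal_sum, Finset.sum_filter]
    · refine Finset.sum_congr rfl fun y hy => ?_
      rw [Measure.smul_apply, Measure.dirac_apply' _ (hp i)]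
      by_cases h : p y = i <;> simp [h, hw y hy]
    · intro y _
      rw [Measure.smul_apply, Measure.dirac_apply' _ (hp i)]
      by_cases h : p y = i <;> simp [h]
  have h := Finset.sum_le_sum fun i (_ : i ∈ (Finset.univ : Finset ι)) =>
    sum_negMulLog_le (E.filter fun y => p y = i) w
      (fun y hy => hw y (Finset.mem_filter.1 hy).1) hM1 (by
        have := hM i
        rw [show {y ∈ (E : Set X) | p y = i} = ((E.filter fun y => p y = i : Finset X) : Set X) by
          ext; simp, Set.encard_coe_eq_coe_finsetCard] at this
        exact_mod_cast this)
  rw [Finset.sum_fiberwise E p fun y => Real.negMulLog (w y), Finset.sum_add_distrib,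
    ← Finset.sum_mul, Finset.sum_fiberwise E p w, hw1, one_mul] at h
  unfold partitionEntropy
  simpa only [hmass] using h

end Entropy
section Itinerary

variable {X ι : Type*}

/-- The itinerary of `x` with respect to `q` during the time window `[i, i + n)`. -/
def itinerary (g : X → X) (q : X → ι) (i n : ℕ) (x : X) : Fin n → ι :=
  fun k => q (g^[i + k] x)

variable [MeasurableSpace X] {g : X → X} {q : X → ι}

lemma measurableSet_itinerary (hg : Measurable g) (hq : ∀ i, MeasurableSet (q ⁻¹' {i}))
    (i n : ℕ) (s : Fin n → ι) : MeasurableSet (itinerary g q i n ⁻¹' {s}) := by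
  have : itinerary g q i n ⁻¹' {s} = ⋂ k : Fin n, (g^[i + k]) ⁻¹' (q ⁻¹' {s k}) := by
    ext x
    simp [itinerary, funext_iff]
  rw [this]
  exact MeasurableSet.iInter fun k => (hg.iterate _) (hq _)

variable [Fintype ι] (μ : Measure X) [IsProbabilityMeasure μ]

lemma partitionEntropy_itinerary_add_le (hg : Measurable g)
    (hq : ∀ i, MeasurableSet (q ⁻¹' {i})) (i n m : ℕ) :
    partitionEntropy μ (itinerary g q i (n + m)) ≤
      partitionEntropy μ (itinerary g q i n) + partitionEntropy μ (itinerary g q (i + n) m) := by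
  have h1 := measurableSet_itinerary hg hq i n
  have h2 := measurableSet_itinerary hg hq (i + n) m
  refine partitionEntropy_le_add μ h1 h2 Fin.append fun x => funext fun k => ?_
  refine Fin.addCases (fun k => ?_) (fun k => ?_) k
  · simp [itinerary]
  · simp [itinerary, add_assoc]

lemma partitionEntropy_itinerary_mono (hg : Measurable g)
    (hq : ∀ i, MeasurableSet (q ⁻¹' {i})) (i : ℕ) {n m : ℕ} (h : n ≤ m) :
    partitionEntropy μ (itinerary g q i n) ≤ partitionEntropy μ (itinerary g q i m) :=
  partitionEntropy_comp_le μ (measurableSet_itinerary hg hq i m)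
    (fun s (k : Fin n) => s (Fin.castLE h k))

lemma partitionEntropy_itinerary_le (hg : Measurable g)
    (hq : ∀ i, MeasurableSet (q ⁻¹' {i})) (i n : ℕ) :
    partitionEntropy μ (itinerary g q i n) ≤ n * Real.log (Fintype.card ι) := by
  classical
  have := partitionEntropy_le_log μ (measurableSet_itinerary hg hq i n) Finset.univ
    (by simp) le_rfl
  simpa using this

lemma sum_partitionEntropy_blocks_le (hg : Measurable g)
    (hq : ∀ i, MeasurableSet (q ⁻¹' {i})) (r T : ℕ) :
    ∑ j ∈ Finset.range r, partitionEntropy μ (itinerary g q 0 (j + T * r)) ≤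
      r * (r * Real.log (Fintype.card ι)) +
        ∑ i ∈ Finset.range (T * r), partitionEntropy μ (itinerary g q i r) := by
  induction T with
  | zero =>
    rw [zero_mul, Finset.range_zero, Finset.sum_empty, add_zero]
    calc ∑ j ∈ Finset.range r, partitionEntropy μ (itinerary g q 0 j)
        ≤ ∑ j ∈ Finset.range r, (r : ℝ) * Real.log (Fintype.card ι) := by
          refine Finset.sum_le_sum fun j hj => ?_
          exact (partitionEntropy_itinerary_mono μ hg hq 0 (Finset.mem_range.1 hj).le).trans
            (partitionEntropy_itinerary_le μ hg hq 0 r)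
      _ = _ := by simp
  | succ T ih =>
    have h : ∀ j ∈ Finset.range r, partitionEntropy μ (itinerary g q 0 (j + (T + 1) * r)) ≤
        partitionEntropy μ (itinerary g q 0 (j + T * r)) +
          partitionEntropy μ (itinerary g q (T * r + j) r) := by
      intro j _
      have := partitionEntropy_itinerary_add_le μ hg hq 0 (j + T * r) r
      rw [zero_add, add_comm j (T * r)] at this
      rw [show j + (T + 1) * r = T * r + j + r by ring, add_comm j (T * r)]
      exact this
    refine (Finset.sum_le_sum h).trans ?_
    rw [Finset.sum_add_distrib, add_mul, one_mul, Finset.sum_range_add]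
    linarith

lemma mul_partitionEntropy_itinerary_le (hg : Measurable g)
    (hq : ∀ i, MeasurableSet (q ⁻¹' {i})) {r : ℕ} (hr : 0 < r) (n : ℕ) :
    r * partitionEntropy μ (itinerary g q 0 n) ≤
      2 * (r * (r * Real.log (Fintype.card ι))) +
        ∑ i ∈ Finset.range n, partitionEntropy μ (itinerary g q i r) := by
  have h1 := sum_partitionEntropy_blocks_le μ hg hq r (n / r + 1)
  have h2 : n ≤ (n / r + 1) * r := by
    have e1 := Nat.div_add_mod n r
    have e2 := Nat.mod_lt n hr
    rw [add_mul, one_mul, mul_comm]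
    lia
  have h3 : (n / r + 1) * r ≤ n + r := by
    rw [add_mul, one_mul]
    exact Nat.add_le_add_right (Nat.div_mul_le_self n r) r
  have h4 : (r : ℝ) * partitionEntropy μ (itinerary g q 0 n) ≤
      ∑ j ∈ Finset.range r, partitionEntropy μ (itinerary g q 0 (j + (n / r + 1) * r)) := by
    have := Finset.sum_le_sum fun j (_ : j ∈ Finset.range r) =>
      partitionEntropy_itinerary_mono μ hg hq 0 (h2.trans (Nat.le_add_left _ j))
    simpa using this
  have h5 : ∑ i ∈ Finset.range ((n / r + 1) * r), partitionEntropy μ (itinerary g q i r) ≤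
      ∑ i ∈ Finset.range (n + r), partitionEntropy μ (itinerary g q i r) :=
    Finset.sum_le_sum_of_subset_of_nonneg (by simpa using h3)
      fun _ _ _ => partitionEntropy_nonneg μ _
  have h6 : ∑ i ∈ Finset.range r, partitionEntropy μ (itinerary g q (n + i) r) ≤
      r * (r * Real.log (Fintype.card ι)) := by
    have := Finset.sum_le_sum fun j (_ : j ∈ Finset.range r) =>
      partitionEntropy_itinerary_le μ hg hq (n + j) r
    simpa using this
  rw [Finset.sum_range_add] at h5
  linarith

lemma partitionEntropy_itinerary_le_of_invariant (hg : Measurable g) (hμ : μ.map g = μ)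
    (hq : ∀ i, MeasurableSet (q ⁻¹' {i})) (n : ℕ) :
    partitionEntropy μ (itinerary g q 0 n) ≤ n * partitionEntropy μ q := by
  have hinv : ∀ i, μ.map (g^[i]) = μ := fun i =>
    ((⟨hg, hμ⟩ : MeasurePreserving g μ μ).iterate i).map_eq
  induction n with
  | zero =>
    have := partitionEntropy_itinerary_le μ hg hq 0 0
    simpa using this
  | succ n ih =>
    have h1 := partitionEntropy_itinerary_add_le μ hg hq 0 n 1
    have h2 : partitionEntropy μ (itinerary g q (0 + n) 1) ≤ partitionEntropy μ q := by
      have h3 := partitionEntropy_map μ (hg.iterate n) hq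
      rw [hinv n] at h3
      rw [h3]
      have h4 : itinerary g q (0 + n) 1 = fun x => (fun s (_ : Fin 1) => s) (q (g^[n] x)) := by
        funext x k
        simp [itinerary]
      rw [h4]
      exact partitionEntropy_comp_le μ (p := fun x => q (g^[n] x))
        (fun i => (hg.iterate n) (hq i)) (fun s (_ : Fin 1) => s)
    push_cast
    linarith

end Itinerary

/-- Entropy is a concave function of the measure. -/
lemma sum_partitionEntropy_le {X ι : Type*} [MeasurableSpace X] [Fintype ι] {n : ℕ} (hn : 0 < n)
    (ν : ℕ → Measure X) (μ : Measure X) (p : X → ι)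
    (h : ∀ i, μ.real (p ⁻¹' {i}) = (∑ k ∈ Finset.range n, (ν k).real (p ⁻¹' {i})) / n) :
    ∑ k ∈ Finset.range n, partitionEntropy (ν k) p ≤ n * partitionEntropy μ p := by
  have hn' : (0 : ℝ) < n := by exact_mod_cast hn
  unfold partitionEntropy
  rw [Finset.sum_comm, Finset.mul_sum]
  refine Finset.sum_le_sum fun i _ => ?_
  have := Real.concaveOn_negMulLog.le_map_sum (t := Finset.range n) (w := fun _ => (n : ℝ)⁻¹)
    (p := fun k => (ν k).real (p ⁻¹' {i})) (fun _ _ => by positivity)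
    (by simp [hn'.ne']) (fun _ _ => measureReal_nonneg)
  simp only [smul_eq_mul, ← Finset.mul_sum] at this
  rw [← div_eq_inv_mul, ← div_eq_inv_mul, ← h, div_le_iff₀ hn', mul_comm] at this
  exact this
lemma encard_biUnion_le_mul {X Y : Type*} {S : Set X} {T : Set Y} (R : Y → Set X) {A B : ℕ}
    (hS : ∀ x ∈ S, ∃ z ∈ T, x ∈ R z) (hT : T.encard ≤ A) (hR : ∀ z ∈ T, (R z).encard ≤ B) :
    S.encard ≤ (A * B : ℕ) := by
  have hfin : T.Finite := Set.finite_of_encard_le_coe hT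
  lift T to Finset Y using hfin
  have h1 : S ⊆ ⋃ z ∈ T, R z := fun x hx => by
    obtain ⟨z, hz, h⟩ := hS x hx
    exact Set.mem_biUnion (by exact_mod_cast hz) h
  refine (Set.encard_le_encard h1).trans ((T.set_encard_biUnion_le R).trans ?_)
  rw [Set.encard_coe_eq_coe_finsetCard] at hT
  calc ∑ z ∈ T, (R z).encard ≤ ∑ z ∈ T, (B : ℕ∞) :=
        Finset.sum_le_sum fun z hz => hR z (by exact_mod_cast hz)
    _ = (T.card : ℕ∞) * B := by simp
    _ ≤ (A * B : ℕ) := by push_cast; gcongr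

/-- A set of reals whose points are separated by the points of `C` has at most `#C + 1` points. -/
lemma encard_le_card_add_one {S : Set ℝ} (C : Finset ℝ)
    (h : ∀ x ∈ S, ∀ y ∈ S, x < y → ∃ c ∈ C, x < c ∧ c < y) : S.encard ≤ (C.card + 1 : ℕ) := by
  classical
  have hlt : ∀ x ∈ S, ∀ y ∈ S, x < y →
      (C.filter (· < x)).card < (C.filter (· < y)).card := by
    intro x hx y hy hxy
    obtain ⟨c, hc, h1, h2⟩ := h x hx y hy hxy
    refine Finset.card_lt_card ⟨fun d hd => ?_, fun hsub => ?_⟩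
    · simp only [Finset.mem_filter] at hd ⊢
      exact ⟨hd.1, hd.2.trans hxy⟩
    · have := hsub (Finset.mem_filter.2 ⟨hc, h2⟩)
      exact (Finset.mem_filter.1 this).2.not_gt h1
  have := Set.encard_le_encard_of_injOn (s := S)
    (t := ((Finset.range (C.card + 1) : Finset ℕ) : Set ℕ))
    (f := fun x => (C.filter (· < x)).card)
    (fun x _ => by
      simpa [Nat.lt_succ_iff] using Finset.card_filter_le C (· < x))
    (fun x hx y hy hxy => by
      rcases lt_trichotomy x y with hlt' | heq | hlt'
      · exact absurd hxy (hlt x hx y hy hlt').ne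
      · exact heq
      · exact absurd hxy (hlt y hy x hx hlt').ne')
  rwa [Set.encard_coe_eq_coe_finsetCard, Finset.card_range] at this

/-- Two points of `I` with the same image under `g` are separated by a point of `C`. -/
def SeparatesFibers (g : ℝ → ℝ) (I : Set ℝ) (C : Finset ℝ) : Prop :=
  ∀ x ∈ I, ∀ y ∈ I, x < y → g x = g y → ∃ c ∈ C, x < c ∧ c < y

lemma SeparatesFibers.encard_fiber_le {g : ℝ → ℝ} {I : Set ℝ} {C : Finset ℝ}
    (h : SeparatesFibers g I C) (z : ℝ) : {y ∈ I | g y = z}.encard ≤ (C.card + 1 : ℕ) :=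
  encard_le_card_add_one C fun x hx y hy hxy => h x hx.1 y hy.1 hxy (hx.2.trans hy.2.symm)

lemma encard_fiber_iterate_le {g : ℝ → ℝ} {I : Set ℝ} (hI : MapsTo g I I) {N : ℕ}
    (h : ∀ z, {y ∈ I | g y = z}.encard ≤ N) (n : ℕ) (z : ℝ) :
    {y ∈ I | g^[n] y = z}.encard ≤ (N ^ n : ℕ) := by
  induction n with
  | zero =>
    have : {y ∈ I | g^[0] y = z} ⊆ {z} := fun y hy => hy.2
    simpa using Set.encard_le_encard this
  | succ n ih =>
    rw [pow_succ]
    refine encard_biUnion_le_mul (fun w => {y ∈ I | g y = w}) ?_ ih fun w _ => h w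
    rintro y ⟨hy, hyz⟩
    exact ⟨g y, ⟨hI hy, by simpa using hyz⟩, hy, rfl⟩

lemma SeparatesFibers.exists_iterate {g : ℝ → ℝ} (hg : Continuous g) {a b : ℝ}
    (hI : MapsTo g (Icc a b) (Icc a b)) {C : Finset ℝ} (h : SeparatesFibers g (Icc a b) C)
    (m : ℕ) : ∃ D : Finset ℝ, SeparatesFibers (g^[m]) (Icc a b) D := by
  classical
  induction m with
  | zero => exact ⟨∅, fun x _ y _ hxy h => absurd h hxy.ne⟩
  | succ m ih =>
    obtain ⟨D, hD⟩ := ih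
    have hfin : {y ∈ Icc a b | g^[m] y ∈ C}.Finite := by
      refine Set.finite_of_encard_le_coe (encard_biUnion_le_mul (T := (C : Set ℝ))
        (fun w => {y ∈ Icc a b | g^[m] y = w}) ?_
        (Set.encard_coe_eq_coe_finsetCard C).le
        fun w _ => encard_fiber_iterate_le hI h.encard_fiber_le m w)
      rintro y ⟨hy, hyz⟩
      exact ⟨_, hyz, hy, rfl⟩
    refine ⟨D ∪ hfin.toFinset, fun x hx y hy hxy hgxy => ?_⟩
    by_cases he : g^[m] x = g^[m] y
    · obtain ⟨c, hc, h1⟩ := hD x hx y hy hxy he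
      exact ⟨c, Finset.mem_union_left _ hc, h1⟩
    · have hgm : ContinuousOn (g^[m]) (Icc x y) := (hg.iterate m).continuousOn
      rw [Function.iterate_succ_apply', Function.iterate_succ_apply'] at hgxy
      have hx' := hI.iterate m hx
      have hy' := hI.iterate m hy
      obtain ⟨c, hc, w, hw, hwc⟩ : ∃ c ∈ C, ∃ w ∈ Ioo x y, g^[m] w = c := by
        rcases lt_or_gt_of_ne he with hlt | hlt
        · obtain ⟨c, hc, h1⟩ := h _ hx' _ hy' hlt hgxy
          exact ⟨c, hc, intermediate_value_Ioo hxy.le hgm h1⟩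
        · obtain ⟨c, hc, h1⟩ := h _ hy' _ hx' hlt hgxy.symm
          exact ⟨c, hc, intermediate_value_Ioo' hxy.le hgm h1⟩
      refine ⟨w, Finset.mem_union_right _ ?_, hw⟩
      simp only [Finite.mem_toFinset]
      exact ⟨⟨hx.1.trans hw.1.le, hw.2.le.trans hy.2⟩, hwc ▸ hc⟩

/-- The position of `x` relative to the finite set `T` of cut points. -/
def cutCode (T : Finset ℝ) (x : ℝ) : T → Bool := fun t => decide ((t : ℝ) < x)

lemma measurable_cutCode (T : Finset ℝ) : Measurable (cutCode T) := by
  refine measurable_pi_lambda _ fun t => measurable_to_bool ?_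
  have : (fun x => cutCode T x t) ⁻¹' {true} = Ioi (t : ℝ) := by
    ext x
    simp [cutCode]
  rw [this]
  exact measurableSet_Ioi

lemma measurableSet_cutCode (T : Finset ℝ) (s : T → Bool) :
    MeasurableSet (cutCode T ⁻¹' {s}) :=
  measurable_cutCode T (measurableSet_singleton s)

lemma mem_uIcc_of_cutCode_ne {T : Finset ℝ} {x y : ℝ} (h : cutCode T x ≠ cutCode T y) :
    ∃ t ∈ T, t ∈ uIcc x y := by
  by_contra! hc
  refine h (funext fun t => ?_)
  have := hc t t.2
  rw [mem_uIcc] at this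
  push Not at this
  simp only [cutCode, decide_eq_decide]
  constructor
  · intro h1
    by_contra! h2
    exact (this.2 h2).not_gt h1
  · intro h1
    by_contra! h2
    exact (this.1 h2).not_gt h1

/-- Measurable sets are approximated by finite unions of intervals. -/
lemma exists_cutCode_symmDiff_lt (μ : Measure ℝ) [IsFiniteMeasure μ] {A : Set ℝ}
    (hA : MeasurableSet A) {ε : ENNReal} (hε : 0 < ε) :
    ∃ T : Finset ℝ, ∃ B : Set (T → Bool), μ (symmDiff (cutCode T ⁻¹' B) A) < ε := by
  classical
  let C : Set (Set ℝ) := {A | ∃ T : Finset ℝ, ∃ B : Set (T → Bool), A = cutCode T ⁻¹' B}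
  have hlift : ∀ T T' : Finset ℝ, T ⊆ T' → ∀ B : Set (T → Bool), ∃ B' : Set (T' → Bool),
      cutCode T ⁻¹' B = cutCode T' ⁻¹' B' := fun T T' h B =>
    ⟨(fun s t => s ⟨t.1, h t.2⟩) ⁻¹' B, rfl⟩
  have hpair : ∀ s ∈ C, ∀ t ∈ C, ∃ T : Finset ℝ, ∃ B B' : Set (T → Bool),
      s = cutCode T ⁻¹' B ∧ t = cutCode T ⁻¹' B' := by
    rintro _ ⟨T, B, rfl⟩ _ ⟨T', B', rfl⟩
    obtain ⟨B₁, h₁⟩ := hlift T (T ∪ T') Finset.subset_union_left B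
    obtain ⟨B₂, h₂⟩ := hlift T' (T ∪ T') Finset.subset_union_right B'
    exact ⟨T ∪ T', B₁, B₂, h₁, h₂⟩
  have hC : IsSetRing C := by
    refine ⟨⟨∅, ∅, rfl⟩, fun s t hs ht => ?_, fun s t hs ht => ?_⟩
    · obtain ⟨T, B, B', rfl, rfl⟩ := hpair s hs t ht
      exact ⟨T, B ∪ B', rfl⟩
    · obtain ⟨T, B, B', rfl, rfl⟩ := hpair s hs t ht
      exact ⟨T, B \ B', rfl⟩
  have hgen : (inferInstance : MeasurableSpace ℝ) = MeasurableSpace.generateFrom C := by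
    apply le_antisymm
    · rw [BorelSpace.measurable_eq (α := ℝ), borel_eq_generateFrom_Ioi]
      refine MeasurableSpace.generateFrom_mono ?_
      rintro _ ⟨t, rfl⟩
      refine ⟨{t}, {s | s ⟨t, by simp⟩ = true}, ?_⟩
      ext x
      simp [cutCode]
    · refine MeasurableSpace.generateFrom_le ?_
      rintro _ ⟨T, B, rfl⟩
      exact measurable_cutCode T (Set.toFinite B).measurableSet
  obtain ⟨_, ⟨T, B, rfl⟩, h⟩ := exists_measure_symmDiff_lt_of_generateFrom_isSetRing (μ := μ) hC
    ⟨{univ}, by simp, by simpa using! ⟨∅, univ, rfl⟩, by simp⟩ hgen hA hε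
  exact ⟨T, B, h⟩
/-- A finite set meeting `[x, y]` distinguishes the ranks of `x` and `y`. -/
lemma card_filter_ne_of_mem_uIcc {D : Finset ℝ} {x y w : ℝ} (hxy : x ≠ y) (hw : w ∈ D)
    (hwxy : w ∈ uIcc x y) :
    ((D.filter (· < x)).card, (D.filter (· ≤ x)).card) ≠
      ((D.filter (· < y)).card, (D.filter (· ≤ y)).card) := by
  wlog hlt : x < y generalizing x y
  · exact (this hxy.symm (by rwa [uIcc_comm]) (lt_of_le_of_ne (not_lt.1 hlt) hxy.symm)).symm
  rw [uIcc_of_le hlt.le] at hwxy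
  intro h
  rw [Prod.mk.injEq] at h
  have h1 : (D.filter (· < x)).card < (D.filter (· ≤ y)).card := by
    refine Finset.card_lt_card ⟨fun d hd => ?_, fun hsub => ?_⟩
    · simp only [Finset.mem_filter] at hd ⊢
      exact ⟨hd.1, (hd.2.trans hlt).le⟩
    · exact (Finset.mem_filter.1 (hsub (Finset.mem_filter.2 ⟨hw, hwxy.2⟩))).2.not_ge hwxy.1
  have h2 : (D.filter (· ≤ x)).card ≤ (D.filter (· < y)).card := by
    refine Finset.card_le_card fun d hd => ?_
    simp only [Finset.mem_filter] at hd ⊢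
    exact ⟨hd.1, hd.2.trans_lt hlt⟩
  lia

/-- Entropy of the itineraries with respect to a finite partition into intervals. -/
lemma partitionEntropy_itinerary_cutCode_le {g : ℝ → ℝ} (hg : Continuous g) {a b : ℝ}
    (hI : MapsTo g (Icc a b) (Icc a b)) {N : ℕ} (hN1 : 1 ≤ N)
    (hN : ∀ z, {y ∈ Icc a b | g y = z}.encard ≤ N) (μ : Measure ℝ) [IsProbabilityMeasure μ]
    (hμ : μ (Icc a b)ᶜ = 0) (T : Finset ℝ) (n : ℕ) :
    partitionEntropy μ (itinerary g (cutCode T) 0 n) ≤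
      2 * Real.log (n * (T.card * N ^ n) + 1) := by
  classical
  have hDcard : {y ∈ Icc a b | ∃ i < n, g^[i] y ∈ T}.encard ≤ (n * (T.card * N ^ n) : ℕ) := by
    refine encard_biUnion_le_mul (T := ((Finset.range n : Finset ℕ) : Set ℕ))
      (fun i => {y ∈ Icc a b | g^[i] y ∈ T}) ?_ (by rw [Set.encard_coe_eq_coe_finsetCard]; simp) ?_
    · rintro y ⟨hy, i, hi, h⟩
      exact ⟨i, by simpa using hi, hy, h⟩
    · intro i hi
      refine encard_biUnion_le_mul (T := (T : Set ℝ)) (fun w => {y ∈ Icc a b | g^[i] y = w}) ?_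
        (Set.encard_coe_eq_coe_finsetCard T).le fun w _ => ?_
      · rintro y ⟨hy, h⟩
        exact ⟨_, h, hy, rfl⟩
      · refine (encard_fiber_iterate_le hI hN i w).trans ?_
        have : i ≤ n := by
          have : i < n := by simpa using hi
          exact this.le
        exact_mod_cast Nat.pow_le_pow_right hN1 this
  have hfin := Set.finite_of_encard_le_coe hDcard
  set D := hfin.toFinset with hD
  have hDc : D.card ≤ n * (T.card * N ^ n) := by
    rw [hfin.encard_eq_coe_toFinset_card] at hDcard
    exact_mod_cast hDcard
  let rk : ℝ → ℕ × ℕ := fun x => ((D.filter (· < x)).card, (D.filter (· ≤ x)).card)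
  have hrk : ∀ x ∈ Icc a b, ∀ y ∈ Icc a b, rk x = rk y →
      itinerary g (cutCode T) 0 n x = itinerary g (cutCode T) 0 n y := by
    intro x hx y hy hxy
    by_contra hne
    obtain ⟨k, hk⟩ := Function.ne_iff.1 hne
    obtain ⟨t, ht, htm⟩ := mem_uIcc_of_cutCode_ne hk
    rw [zero_add] at htm
    obtain ⟨w, hw, hwt⟩ := intermediate_value_uIcc (hg.iterate k).continuousOn htm
    refine card_filter_ne_of_mem_uIcc (fun h => hne (by rw [h])) (w := w) ?_ hw hxy
    simp only [hD, Finite.mem_toFinset]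
    exact ⟨uIcc_subset_Icc hx hy hw, k, k.2, hwt ▸ ht⟩
  let F : Finset (Fin n → T → Bool) :=
    Finset.univ.filter fun s => ∃ x ∈ Icc a b, itinerary g (cutCode T) 0 n x = s
  have hF : F.card ≤ (D.card + 1) * (D.card + 1) := by
    have hex : ∀ s ∈ F, ∃ x ∈ Icc a b, itinerary g (cutCode T) 0 n x = s :=
      fun s hs => (Finset.mem_filter.1 hs).2
    choose! c hcI hcs using hex
    have := Finset.card_le_card_of_injOn (s := F)
      (t := Finset.range (D.card + 1) ×ˢ Finset.range (D.card + 1)) (fun s => rk (c s))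
      (fun s _ => by
        simp only [rk, Finset.coe_product, Finset.coe_range, mem_prod, mem_Iio, Nat.lt_succ_iff]
        exact ⟨Finset.card_filter_le _ _, Finset.card_filter_le _ _⟩)
      (fun s hs s' hs' h => by
        rw [← hcs s hs, ← hcs s' hs']
        exact hrk _ (hcI s hs) _ (hcI s' hs') h)
    simpa using this
  have key := partitionEntropy_le_log μ
    (measurableSet_itinerary hg.measurable (measurableSet_cutCode T) 0 n) F (fun s hs => by
      refine measure_mono_null (t := (Icc a b)ᶜ) (fun x hx hxI => hs ?_) hμ
      exact Finset.mem_filter.2 ⟨Finset.mem_univ _, x, hxI, hx⟩) hF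
  refine key.trans ?_
  push_cast
  rw [Real.log_mul (by positivity) (by positivity), ← two_mul]
  have : (D.card : ℝ) ≤ n * (T.card * N ^ n) := by exact_mod_cast hDc
  gcongr

/-- A partition whose nontrivial cells have small mass has small entropy. -/
lemma partitionEntropy_le_of_compl_le {X : Type*} [MeasurableSpace X] {k : ℕ} (μ : Measure X)
    [IsProbabilityMeasure μ] {e : X → Fin k → Bool} (he : ∀ s, MeasurableSet (e ⁻¹' {s}))
    (h : μ.real {x | e x ≠ fun _ => false} * k ≤ 1) : partitionEntropy μ e ≤ 3 := by
  classical
  set z : Fin k → Bool := fun _ => false with hz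
  have h1 := sum_negMulLog_le (Finset.univ.erase z) (fun s => μ.real (e ⁻¹' {s}))
    (fun _ _ => measureReal_nonneg) (M := 2 ^ k) Nat.one_le_two_pow
    ((Finset.card_le_univ _).trans (by simp))
  have h2 : ∑ s ∈ Finset.univ.erase z, μ.real (e ⁻¹' {s}) = μ.real {x | e x ≠ z} := by
    rw [← measureReal_biUnion_finset]
    · congr 1
      ext x
      simp
    · intro i _ j _ hij
      exact Disjoint.preimage _ (by simpa using hij)
    · exact fun i _ => he i
  have h3 : partitionEntropy μ e = Real.negMulLog (μ.real (e ⁻¹' {z})) +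
      ∑ s ∈ Finset.univ.erase z, Real.negMulLog (μ.real (e ⁻¹' {s})) :=
    (Finset.add_sum_erase _ _ (Finset.mem_univ z)).symm
  rw [h2] at h1
  have h4 := Real.negMulLog_le_one_sub_self (measureReal_nonneg (μ := μ) (s := e ⁻¹' {z}))
  have h5 := Real.negMulLog_le_one_sub_self (measureReal_nonneg (μ := μ) (s := {x | e x ≠ z}))
  have h6 := measureReal_nonneg (μ := μ) (s := e ⁻¹' {z})
  have h7 := measureReal_nonneg (μ := μ) (s := {x | e x ≠ z})
  have h8 : Real.log ((2 ^ k : ℕ) : ℝ) ≤ k := by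
    push_cast
    rw [Real.log_pow]
    have := Real.log_two_lt_d9
    have h9 : (0 : ℝ) ≤ k := by positivity
    nlinarith
  have h9 := mul_le_mul_of_nonneg_left h8 h7
  linarith

/-- Every measurable partition is coarser than an interval partition joined with a partition of
small entropy. -/
lemma exists_cutCode_approx (μ : Measure ℝ) [IsProbabilityMeasure μ] {k : ℕ} {p : ℝ → Fin k}
    (hp : ∀ i, MeasurableSet (p ⁻¹' {i})) :
    ∃ T : Finset ℝ, ∃ e : ℝ → Fin k → Bool, (∀ s, MeasurableSet (e ⁻¹' {s})) ∧
      partitionEntropy μ e ≤ 3 ∧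
      ∃ G : (T → Bool) × (Fin k → Bool) → Fin k, ∀ x, p x = G (cutCode T x, e x) := by
  classical
  have hk : 0 < k := (p 0).pos
  have hkR : (0 : ℝ) < k := by exact_mod_cast hk
  have hε : (0 : ℝ) < 1 / (k * k) := by positivity
  choose T B hTB using fun i =>
    exists_cutCode_symmDiff_lt μ (hp i) (ENNReal.ofReal_pos.2 hε)
  set U := Finset.univ.biUnion T with hU
  have hTU : ∀ i, T i ⊆ U := fun i => Finset.subset_biUnion_of_mem T (Finset.mem_univ i)
  let r : ∀ i, (U → Bool) → T i → Bool := fun i s t => s ⟨t.1, hTU i t.2⟩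
  have hr : ∀ i x, r i (cutCode U x) = cutCode (T i) x := fun i x => rfl
  let e : ℝ → Fin k → Bool := fun x i => xor (decide (cutCode (T i) x ∈ B i)) (decide (p x = i))
  have hesd : ∀ i, {x | e x i = true} = symmDiff (cutCode (T i) ⁻¹' B i) (p ⁻¹' {i}) := by
    intro i
    ext x
    simp only [e, mem_ofPred_eq, mem_symmDiff, mem_preimage, mem_singleton_iff]
    by_cases h1 : cutCode (T i) x ∈ B i <;> by_cases h2 : p x = i <;> simp [h1, h2]
  have hmeas : ∀ i, MeasurableSet {x | e x i = true} := fun i => by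
    rw [hesd]
    exact (measurable_cutCode _ (Set.toFinite (B i)).measurableSet).symmDiff (hp i)
  have he : Measurable e := measurable_pi_lambda _ fun i => measurable_to_bool (hmeas i)
  refine ⟨U, e, fun s => he (measurableSet_singleton s), ?_, ?_⟩
  · refine partitionEntropy_le_of_compl_le μ (fun s => he (measurableSet_singleton s)) ?_
    have h1 : {x | e x ≠ fun _ => false} ⊆ ⋃ i ∈ (Finset.univ : Finset (Fin k)),
        {x | e x i = true} := by
      intro x hx
      obtain ⟨i, hi⟩ := Function.ne_iff.1 hx
      simp only [Finset.mem_univ, iUnion_true, mem_iUnion]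
      exact ⟨i, by simpa using hi⟩
    have h2 : μ.real {x | e x ≠ fun _ => false} ≤ k * (1 / (k * k)) := by
      refine (measureReal_mono h1 (measure_ne_top _ _)).trans ((measureReal_biUnion_finset_le _ _).trans ?_)
      have : ∀ i ∈ (Finset.univ : Finset (Fin k)),
          μ.real {x | e x i = true} ≤ 1 / ((k : ℝ) * k) := by
        intro i _
        rw [hesd]
        exact ENNReal.toReal_le_of_le_ofReal hε.le (hTB i).le
      refine (Finset.sum_le_sum this).trans ?_
      simp
    calc μ.real {x | e x ≠ fun _ => false} * k ≤ k * (1 / (k * k)) * k := by gcongr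
      _ = 1 := by field_simp
  · let G : (U → Bool) × (Fin k → Bool) → Fin k := fun s =>
      if h : ∃ i, xor (decide (r i s.1 ∈ B i)) (s.2 i) = true then h.choose else ⟨0, hk⟩
    refine ⟨G, fun x => ?_⟩
    have hiff : ∀ i, xor (decide (r i (cutCode U x) ∈ B i)) (e x i) = true ↔ p x = i := by
      intro i
      rw [hr]
      by_cases h1 : cutCode (T i) x ∈ B i <;> by_cases h2 : p x = i <;> simp [e, h1, h2]
    have hex : ∃ i, xor (decide (r i (cutCode U x) ∈ B i)) (e x i) = true :=
      ⟨p x, (hiff _).2 rfl⟩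
    simp only [G, dif_pos hex]
    exact (hiff _).1 hex.choose_spec

/-- The entropies of all measurable partitions are uniformly bounded. -/
lemma iInf_partitionEntropy_le {g : ℝ → ℝ} (hg : Continuous g) {a b : ℝ}
    (hI : MapsTo g (Icc a b) (Icc a b)) {N : ℕ} (hN1 : 1 ≤ N)
    (hN : ∀ z, {y ∈ Icc a b | g y = z}.encard ≤ N) (μ : Measure ℝ) [IsProbabilityMeasure μ]
    (hμ : μ (Icc a b)ᶜ = 0) (hinv : μ.map g = μ) {k : ℕ} {p : ℝ → Fin k} (hp : Measurable p) :
    ⨅ n : ℕ, partitionEntropy μ (itinerary g p 0 (n + 1)) / (n + 1) ≤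
      2 * (1 + Real.log (2 * N)) + 3 := by
  classical
  have hp' : ∀ i, MeasurableSet (p ⁻¹' {i}) := fun i => hp (measurableSet_singleton i)
  obtain ⟨T, e, he, he3, G, hG⟩ := exists_cutCode_approx μ hp'
  obtain ⟨n, hn⟩ := exists_nat_ge (Real.log (T.card + 1))
  have hbdd : BddBelow (Set.range fun n : ℕ =>
      partitionEntropy μ (itinerary g p 0 (n + 1)) / ((n : ℝ) + 1)) := by
    refine ⟨0, ?_⟩
    rintro _ ⟨n, rfl⟩
    have := partitionEntropy_nonneg μ (itinerary g p 0 (n + 1))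
    positivity
  refine (ciInf_le hbdd n).trans ?_
  rw [div_le_iff₀ (by positivity)]
  have hT' := measurableSet_itinerary hg.measurable (measurableSet_cutCode T) 0 (n + 1)
  have he' := measurableSet_itinerary hg.measurable he 0 (n + 1)
  have h1 : partitionEntropy μ (itinerary g p 0 (n + 1)) ≤
      partitionEntropy μ (itinerary g (cutCode T) 0 (n + 1)) +
        partitionEntropy μ (itinerary g e 0 (n + 1)) := by
    refine partitionEntropy_le_add μ hT' he' (fun s t i => G (s i, t i)) fun x => funext fun i => ?_
    simp [itinerary, hG]
  have h2 := partitionEntropy_itinerary_cutCode_le hg hI hN1 hN μ hμ T (n + 1)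
  have h3 := partitionEntropy_itinerary_le_of_invariant μ hg.measurable hinv he (n + 1)
  have hNR : (1 : ℝ) ≤ N := by exact_mod_cast hN1
  have h5 : ((n + 1 : ℕ) : ℝ) * (T.card * N ^ (n + 1)) + 1 ≤
      (T.card + 1) * (2 * N) ^ (n + 1) := by
    have e1 : ((n + 1 : ℕ) : ℝ) ≤ 2 ^ (n + 1) := by exact_mod_cast Nat.lt_two_pow_self.le
    have e2 : (1 : ℝ) ≤ (2 * N) ^ (n + 1) := one_le_pow₀ (by linarith)
    have e3 : ((n + 1 : ℕ) : ℝ) * (T.card * N ^ (n + 1)) ≤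
        2 ^ (n + 1) * (T.card * N ^ (n + 1)) := by gcongr
    rw [mul_pow] at e2 ⊢
    nlinarith
  have h6 := Real.log_le_log (by positivity) h5
  rw [Real.log_mul (by positivity) (by positivity), Real.log_pow] at h6
  push_cast at h2 h3 h6
  have h7 : ((n : ℝ) + 1) * partitionEntropy μ e ≤ (n + 1) * 3 := by gcongr
  nlinarith
/-- The average of the images of the weighted preimage measure along its orbit. -/
lemma exists_orbit_average {g : ℝ → ℝ} (hg : Continuous g) {I : Set ℝ} (hIm : MeasurableSet I)
    (hI : MapsTo g I I) (φ : BoundedContinuousFunction ℝ ℝ) (E : Finset ℝ) (hE : E.Nonempty)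
    (hEI : ∀ y ∈ E, y ∈ I) {n : ℕ} (hn : 0 < n) :
    ∃ μ : Measure ℝ, IsProbabilityMeasure μ ∧ μ Iᶜ = 0 ∧
      (∀ h : BoundedContinuousFunction ℝ ℝ,
        |∫ x, h (g x) ∂μ - ∫ x, h x ∂μ| ≤ 2 * ‖h‖ / n) ∧
      ∀ (K : ℕ) (q : ℝ → Fin K), (∀ i, MeasurableSet (q ⁻¹' {i})) → ∀ (r M : ℕ), 0 < r → 1 ≤ M →
        (∀ s, ({y ∈ (E : Set ℝ) | itinerary g q 0 n y = s}).encard ≤ M) →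
        r * Real.log (∑ y ∈ E, Real.exp (birkhoffSum g φ n y)) ≤
          r * Real.log M + 2 * (r * (r * Real.log K)) +
            n * partitionEntropy μ (itinerary g q 0 r) + r * (n * ∫ x, φ x ∂μ) := by
  have hnR : (0 : ℝ) < n := by exact_mod_cast hn
  set S : ℝ → ℝ := birkhoffSum g φ n with hS
  set Z : ℝ := ∑ y ∈ E, Real.exp (S y) with hZ
  have hZpos : 0 < Z := Finset.sum_pos (fun y _ => Real.exp_pos _) hE
  set w : ℝ → ℝ := fun y => Real.exp (S y) / Z with hw
  have hw0 : ∀ y, 0 ≤ w y := fun y => by positivity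
  have hw1 : ∑ y ∈ E, w y = 1 := by rw [hw, ← Finset.sum_div, div_self hZpos.ne']
  set ν : Measure ℝ := ∑ y ∈ E, ENNReal.ofReal (w y) • Measure.dirac y with hν
  have hνp : IsProbabilityMeasure ν := ⟨by
    rw [hν, Measure.finsetSum_apply]
    simp only [Measure.smul_apply, measure_univ, smul_eq_mul, mul_one]
    rw [← ENNReal.ofReal_sum_of_nonneg fun y _ => hw0 y, hw1, ENNReal.ofReal_one]⟩
  have hνI : ν Iᶜ = 0 := by
    rw [hν, Measure.finsetSum_apply]
    refine Finset.sum_eq_zero fun y hy => ?_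
    rw [Measure.smul_apply, Measure.dirac_apply' _ hIm.compl]
    simp [hEI y hy]
  have hint : ∀ h : ℝ → ℝ, ∫ x, h x ∂ν = ∑ y ∈ E, w y * h y := by
    intro h
    rw [hν, integral_finsetSum_measure]
    · refine Finset.sum_congr rfl fun y _ => ?_
      rw [integral_smul_measure, integral_dirac, ENNReal.toReal_ofReal (hw0 y), smul_eq_mul]
    · intro y _
      exact (integrable_dirac (by simp)).smul_measure ENNReal.ofReal_ne_top
  have hgi : ∀ i, Measurable (g^[i]) := fun i => hg.measurable.iterate i
  have hprob : ∀ i, IsProbabilityMeasure (ν.map (g^[i])) := fun i =>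
    Measure.isProbabilityMeasure_map (hgi i).aemeasurable
  set μ : Measure ℝ := (n : ENNReal)⁻¹ • ∑ i ∈ Finset.range n, ν.map (g^[i]) with hμ
  have hμapp : ∀ A, μ.real A = (∑ i ∈ Finset.range n, (ν.map (g^[i])).real A) / n := by
    intro A
    rw [hμ, measureReal_ennreal_smul_apply, Measure.real, Measure.finsetSum_apply,
      ENNReal.toReal_sum fun i _ => measure_ne_top _ _, ENNReal.toReal_inv,
      ENNReal.toReal_natCast, inv_mul_eq_div]
    rfl
  have hμp : IsProbabilityMeasure μ := ⟨by
    rw [hμ, Measure.smul_apply, Measure.finsetSum_apply]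
    simp only [measure_univ, Finset.sum_const, Finset.card_range, nsmul_eq_mul, mul_one,
      smul_eq_mul]
    exact ENNReal.inv_mul_cancel (by exact_mod_cast hn.ne') (ENNReal.natCast_ne_top n)⟩
  have hμint : ∀ h : BoundedContinuousFunction ℝ ℝ,
      ∫ x, h x ∂μ = (∑ i ∈ Finset.range n, ∫ x, h (g^[i] x) ∂ν) / n := by
    intro h
    rw [hμ, integral_smul_measure, integral_finsetSum_measure fun i _ => h.integrable _,
      ENNReal.toReal_inv, ENNReal.toReal_natCast, smul_eq_mul, inv_mul_eq_div]
    congr 1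
    refine Finset.sum_congr rfl fun i _ => ?_
    exact integral_map (hgi i).aemeasurable h.continuous.aestronglyMeasurable
  refine ⟨μ, hμp, ?_, fun h => ?_, fun K q hq r M hr hM1 hM => ?_⟩
  · rw [hμ, Measure.smul_apply, Measure.finsetSum_apply, Finset.sum_eq_zero, smul_zero]
    intro i _
    rw [Measure.map_apply (hgi i) hIm.compl]
    exact measure_mono_null (fun x hx hxI => hx (hI.iterate i hxI)) hνI
  · have h1 := hμint (h.compContinuous ⟨g, hg⟩)
    simp only [BoundedContinuousFunction.compContinuous_apply, ContinuousMap.coe_mk] at h1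
    rw [h1, hμint h, ← sub_div, ← Finset.sum_sub_distrib]
    have h2 : ∑ i ∈ Finset.range n, (∫ x, h (g (g^[i] x)) ∂ν - ∫ x, h (g^[i] x) ∂ν) =
        ∫ x, h (g^[n] x) ∂ν - ∫ x, h x ∂ν := by
      have := Finset.sum_range_sub (fun i => ∫ x, h (g^[i] x) ∂ν) n
      simpa only [Function.iterate_succ_apply', Function.iterate_zero, id] using this
    rw [h2, abs_div, abs_of_pos hnR]
    have hb : ∀ i, |∫ x, h (g^[i] x) ∂ν| ≤ ‖h‖ := by
      intro i
      have := norm_integral_le_of_norm_le_const (μ := ν)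
        (Filter.Eventually.of_forall fun x => h.norm_coe_le_norm (g^[i] x))
      simpa using this
    have h3 := hb n
    have h4 := hb 0
    simp only [Function.iterate_zero, id] at h4
    gcongr
    exact (abs_sub _ _).trans (by linarith)
  · have hitin := measurableSet_itinerary hg.measurable hq 0
    have h1 : ∑ y ∈ E, Real.negMulLog (w y) = Real.log Z - ∑ y ∈ E, w y * S y := by
      have : ∀ y ∈ E, Real.negMulLog (w y) = w y * Real.log Z - w y * S y := by
        intro y _
        rw [Real.negMulLog, hw]
        simp only
        rw [Real.log_div (Real.exp_pos _).ne' hZpos.ne', Real.log_exp]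
        ring
      rw [Finset.sum_congr rfl this, Finset.sum_sub_distrib, ← Finset.sum_mul, hw1, one_mul]
    have h2 := sum_negMulLog_le_partitionEntropy E w (fun y _ => hw0 y) hw1 (hitin n) hM1 hM
    have h3 := mul_partitionEntropy_itinerary_le ν hg.measurable hq hr n
    have h4 : ∀ i, partitionEntropy ν (itinerary g q i r) =
        partitionEntropy (ν.map (g^[i])) (itinerary g q 0 r) := by
      intro i
      rw [partitionEntropy_map ν (hgi i) (hitin r)]
      congr 1
      funext x k
      simp only [itinerary, zero_add]
      rw [← Function.iterate_add_apply, add_comm]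
    simp only [h4] at h3
    have h5 := sum_partitionEntropy_le hn (fun i => ν.map (g^[i])) μ (itinerary g q 0 r)
      fun i => hμapp _
    have h6 : ∑ y ∈ E, w y * S y = n * ∫ x, φ x ∂μ := by
      rw [hμint φ, mul_div_cancel₀ _ hnR.ne']
      simp only [hint, hS, birkhoffSum, Finset.mul_sum]
      rw [Finset.sum_comm]
    rw [h1, h6] at h2
    rw [Fintype.card_fin] at h3
    have hrR : (0 : ℝ) < r := by exact_mod_cast hr
    have h7 := mul_le_mul_of_nonneg_left h2 hrR.le
    linarith

/-- Between any two points of a finite set one can cut at a point without mass. -/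
lemma exists_partition_null_frontier (μ : Measure ℝ) [IsFiniteMeasure μ] (D : Finset ℝ) :
    ∃ (K : ℕ) (p : ℝ → Fin K), Measurable p ∧ (∀ i, μ (frontier (p ⁻¹' {i})) = 0) ∧
      ∀ c ∈ D, ∀ c' ∈ D, ∀ x y, x < c → c < c' → c' < y → p x ≠ p y := by
  classical
  have hcount : {t : ℝ | 0 < μ {t}}.Countable :=
    Measure.countable_meas_pos_of_disjoint_iUnion (fun t => measurableSet_singleton t)
      fun s t hst => by simpa [Function.onFun] using hst
  have hcut : ∀ c c' : ℝ, c < c' → ∃ t, μ {t} = 0 ∧ c < t ∧ t < c' := by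
    intro c c' h
    obtain ⟨t, ht, h1⟩ := (hcount.dense_compl ℝ).exists_between h
    exact ⟨t, by simpa using ht, h1⟩
  choose! t ht0 ht1 ht2 using hcut
  let T : Finset ℝ := ((D ×ˢ D).filter fun c => c.1 < c.2).image fun c => t c.1 c.2
  have hT0 : ∀ s ∈ T, μ {s} = 0 := by
    intro s hs
    obtain ⟨c, hc, rfl⟩ := Finset.mem_image.1 hs
    exact ht0 _ _ (Finset.mem_filter.1 hc).2
  let e := Fintype.equivFin (T → Bool)
  have hpre : ∀ i, (fun x => e (cutCode T x)) ⁻¹' {i} = cutCode T ⁻¹' {e.symm i} := by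
    intro i
    ext x
    simp [Equiv.eq_symm_apply]
  refine ⟨_, fun x => e (cutCode T x), ?_, fun i => ?_, ?_⟩
  · refine measurable_to_countable' fun i => ?_
    rw [hpre]
    exact measurableSet_cutCode T _
  · rw [hpre]
    set s := e.symm i
    have h1 : cutCode T ⁻¹' {s} =
        ⋂ u ∈ (Finset.univ : Finset T), {x | decide ((u : ℝ) < x) = s u} := by
      ext x
      simp [cutCode, funext_iff]
    rw [h1]
    generalize (Finset.univ : Finset T) = V
    induction V using Finset.induction_on with
    | empty => simp
    | insert u V _ ih =>
      rw [Finset.set_biInter_insert]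
      refine null_frontier_inter ?_ ih
      rcases hsu : s u with _ | _
      · rw [show {x | decide ((u : ℝ) < x) = false} = Iic (u : ℝ) by ext; simp, frontier_Iic]
        exact hT0 _ u.2
      · rw [show {x | decide ((u : ℝ) < x) = true} = Ioi (u : ℝ) by ext; simp, frontier_Ioi]
        exact hT0 _ u.2
  · intro c hc c' hc' x y hx hcc hy h
    have hmem : t c c' ∈ T :=
      Finset.mem_image.2 ⟨(c, c'), Finset.mem_filter.2 ⟨Finset.mem_product.2 ⟨hc, hc'⟩, hcc⟩, rfl⟩
    have h1 := congrFun (e.injective h) ⟨_, hmem⟩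
    simp only [cutCode, decide_eq_decide] at h1
    exact absurd (h1.2 ((ht2 _ _ hcc).trans hy)) (hx.trans (ht1 _ _ hcc)).not_gt

/-- Itinerary cells of a partition with null frontiers have null frontiers. -/
lemma measure_frontier_itinerary {ι : Type*} {g : ℝ → ℝ} (hg : Continuous g) {μ : Measure ℝ}
    (hinv : μ.map g = μ) {p : ℝ → ι} (hp : ∀ i, μ (frontier (p ⁻¹' {i})) = 0) (n : ℕ)
    (s : Fin n → ι) : μ (frontier (itinerary g p 0 n ⁻¹' {s})) = 0 := by
  classical
  have h1 : itinerary g p 0 n ⁻¹' {s} =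
      ⋂ k ∈ (Finset.univ : Finset (Fin n)), (g^[k]) ⁻¹' (p ⁻¹' {s k}) := by
    ext x
    simp [itinerary, funext_iff]
  rw [h1]
  generalize (Finset.univ : Finset (Fin n)) = V
  induction V using Finset.induction_on with
  | empty => simp
  | insert k V _ ih =>
    rw [Finset.set_biInter_insert]
    refine null_frontier_inter ?_ ih
    refine measure_mono_null ((hg.iterate k).frontier_preimage_subset _) ?_
    rw [((⟨hg.measurable, hinv⟩ : MeasurePreserving g μ μ).iterate k).measure_preimage
      isClosed_frontier.measurableSet.nullMeasurableSet]
    exact hp _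

/-- If `g^m` is at most two-to-one on the cells of `p`, then few points of a fiber of `g^n` share
an itinerary. -/
lemma encard_fiber_itinerary_le {ι : Type*} {g : ℝ → ℝ} {I : Set ℝ} (hI : MapsTo g I I) {N : ℕ}
    (hN1 : 1 ≤ N) (hN : ∀ z, {y ∈ I | g y = z}.encard ≤ N) {m : ℕ} (hm : 0 < m) {p : ℝ → ι}
    (hp : ∀ i z, {y ∈ I | p y = i ∧ g^[m] y = z}.encard ≤ 2) (n : ℕ) (z : ℝ) (s : Fin n → ι) :
    {y ∈ I | g^[n] y = z ∧ itinerary g p 0 n y = s}.encard ≤ (N ^ m * 2 ^ (n / m) : ℕ) := by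
  have hblock : ∀ (k : ℕ) (z : ℝ) (s : ℕ → ι),
      {y ∈ I | g^[m * k] y = z ∧ ∀ j < k, p (g^[m * j] y) = s j}.encard ≤ (2 ^ k : ℕ) := by
    intro k
    induction k with
    | zero =>
      intro z s
      have : {y ∈ I | g^[m * 0] y = z ∧ ∀ j < 0, p (g^[m * j] y) = s j} ⊆ {z} :=
        fun y hy => hy.2.1
      simpa using Set.encard_le_encard this
    | succ k ih =>
      intro z s
      rw [pow_succ]
      refine encard_biUnion_le_mul (fun w => {y ∈ I | p y = s 0 ∧ g^[m] y = w}) ?_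
        (ih z fun j => s (j + 1)) fun w _ => hp _ w
      rintro y ⟨hy, hyz, hj⟩
      refine ⟨g^[m] y, ⟨hI.iterate m hy, ?_, fun j hjk => ?_⟩, hy, hj 0 k.succ_pos, rfl⟩
      · rw [← Function.iterate_add_apply]
        exact hyz
      · rw [← Function.iterate_add_apply]
        exact hj (j + 1) (by lia)
  rcases n.eq_zero_or_pos with rfl | hn
  · have : {y ∈ I | g^[0] y = z ∧ itinerary g p 0 0 y = s} ⊆ {z} := fun y hy => hy.2.1
    refine (Set.encard_le_encard this).trans ?_
    rw [Set.encard_singleton]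
    exact_mod_cast Nat.mul_pos (pow_pos hN1 _) (by simp)
  have hpos : ∀ j < n / m, m * j < n := by
    intro j hj
    calc m * j < m * (n / m) := Nat.mul_lt_mul_of_pos_left hj hm
      _ ≤ n := Nat.mul_div_le n m
  let s' : ℕ → ι := fun j => s ⟨(m * j) % n, Nat.mod_lt _ hn⟩
  have hmod : n % m ≤ m := (Nat.mod_lt n hm).le
  refine encard_biUnion_le_mul (T := {w ∈ I | g^[n % m] w = z})
    (fun w => {y ∈ I | g^[m * (n / m)] y = w ∧ ∀ j < n / m, p (g^[m * j] y) = s' j}) ?_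
    ((encard_fiber_iterate_le hI hN (n % m) z).trans
      (by exact_mod_cast Nat.pow_le_pow_right hN1 hmod)) fun w _ => hblock _ w s'
  rintro y ⟨hy, hyz, hs⟩
  refine ⟨g^[m * (n / m)] y, ⟨hI.iterate _ hy, ?_⟩, hy, rfl, fun j hj => ?_⟩
  · rw [← Function.iterate_add_apply, Nat.mod_add_div]
    exact hyz
  · have := congrFun hs ⟨m * j, hpos j hj⟩
    simp only [itinerary, zero_add] at this
    simp only [s', Nat.mod_eq_of_lt (hpos j hj)]
    exact this

/-- If no cell of `p` reaches past two separating points, then `g` is at most two-to-one on the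
cells of `p`. -/
lemma SeparatesFibers.encard_le_two {ι : Type*} {g : ℝ → ℝ} {I : Set ℝ} {D : Finset ℝ}
    (hD : SeparatesFibers g I D) {p : ℝ → ι}
    (hp : ∀ c ∈ D, ∀ c' ∈ D, ∀ x y, x < c → c < c' → c' < y → p x ≠ p y) (i : ι) (z : ℝ) :
    {y ∈ I | p y = i ∧ g y = z}.encard ≤ 2 := by
  classical
  set S := {y ∈ I | p y = i ∧ g y = z} with hS
  have h1 := encard_le_card_add_one (S := S) (D.filter fun c => ∃ x ∈ S, ∃ y ∈ S, x < c ∧ c < y)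
    fun x hx y hy hxy => by
      obtain ⟨c, hc, h1, h2⟩ := hD x hx.1 y hy.1 hxy (hx.2.2.trans hy.2.2.symm)
      exact ⟨c, Finset.mem_filter.2 ⟨hc, x, hx, y, hy, h1, h2⟩, h1, h2⟩
  have h2 : (D.filter fun c => ∃ x ∈ S, ∃ y ∈ S, x < c ∧ c < y).card ≤ 1 := by
    have key : ∀ c ∈ D.filter fun c => ∃ x ∈ S, ∃ y ∈ S, x < c ∧ c < y,
        ∀ c' ∈ D.filter fun c => ∃ x ∈ S, ∃ y ∈ S, x < c ∧ c < y, ¬ c < c' := by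
      intro c hc c' hc' hlt
      obtain ⟨hcD, x, hx, -, -, hxc, -⟩ := Finset.mem_filter.1 hc
      obtain ⟨hcD', -, -, y, hy, -, hcy⟩ := Finset.mem_filter.1 hc'
      exact hp c hcD c' hcD' x y hxc hlt hcy (hx.2.1.trans hy.2.1.symm)
    rw [Finset.card_le_one]
    exact fun c hc c' hc' => le_antisymm (not_lt.1 (key c' hc' c hc)) (not_lt.1 (key c hc c' hc'))
  refine h1.trans ?_
  exact_mod_cast Nat.add_le_add_right h2 1

/-- Entropy of a finite-valued map whose level sets have null frontier is continuous under weak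
convergence. -/
theorem tendsto_partitionEntropy {α ι : Type*} [Fintype ι] {F : Filter α}
    {μs : α → ProbabilityMeasure ℝ} {μ : ProbabilityMeasure ℝ} (h : Tendsto μs F (nhds μ))
    {q : ℝ → ι} (hq : ∀ s, (μ : Measure ℝ) (frontier (q ⁻¹' {s})) = 0) :
    Tendsto (fun i => partitionEntropy (μs i : Measure ℝ) q) F
      (nhds (partitionEntropy (μ : Measure ℝ) q)) := by
  unfold partitionEntropy
  refine tendsto_finsetSum _ fun s _ => ?_
  refine (Real.continuous_negMulLog.tendsto _).comp ?_
  exact (ENNReal.tendsto_toReal (measure_ne_top _ _)).comp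
    (ProbabilityMeasure.tendsto_measure_of_null_frontier_of_tendsto' h (hq s))

/-- A weak limit of measures on a compact set which are asymptotically invariant under a
continuous map is invariant. -/
theorem exists_invariant_tendsto {g : ℝ → ℝ} (hg : Continuous g) {a b : ℝ}
    {U : Ultrafilter ℕ} (hU : (U : Filter ℕ) ≤ atTop) {μs : ℕ → ProbabilityMeasure ℝ}
    (hμs : ∀ᶠ n in (U : Filter ℕ), (μs n : Measure ℝ) (Icc a b)ᶜ = 0)
    (hinv : ∀ᶠ n : ℕ in (U : Filter ℕ), ∀ h : BoundedContinuousFunction ℝ ℝ,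
      |∫ x, h (g x) ∂(μs n : Measure ℝ) - ∫ x, h x ∂(μs n : Measure ℝ)| ≤ 2 * ‖h‖ / n) :
    ∃ μ : ProbabilityMeasure ℝ, (μ : Measure ℝ) (Icc a b)ᶜ = 0 ∧
      (μ : Measure ℝ).map g = μ ∧ Tendsto μs U (nhds μ) := by
  have hcpt := isCompact_setOfPred_probabilityMeasure_mass_eq_compl_isCompact_le (E := ℝ)
    (u := fun _ => 0) (K := fun _ => Icc a b) tendsto_const_nhds (fun _ => isCompact_Icc)
    (Or.inl inferInstance)
  obtain ⟨μ, hμ, hlim⟩ := hcpt.ultrafilter_le_nhds (U.map μs) (by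
    rw [Ultrafilter.coe_map, le_principal_iff, mem_map]
    filter_upwards [hμs] with n hn k
    simp [ProbabilityMeasure.coeFn_def, hn])
  have hlim : Tendsto μs U (nhds μ) := hlim
  refine ⟨μ, ?_, ?_, hlim⟩
  · have := hμ 0
    simpa [ProbabilityMeasure.coeFn_def, ENNReal.toNNReal_eq_zero_iff] using this
  have hint := ProbabilityMeasure.tendsto_iff_forall_integral_tendsto.1 hlim
  have : IsProbabilityMeasure ((μ : Measure ℝ).map g) :=
    Measure.isProbabilityMeasure_map hg.aemeasurable
  refine ext_of_forall_integral_eq_of_IsFiniteMeasure fun h => ?_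
  rw [integral_map hg.aemeasurable h.continuous.aestronglyMeasurable]
  have h1 := (hint (h.compContinuous ⟨g, hg⟩)).sub (hint h)
  have h0 : Tendsto (fun n : ℕ => 2 * ‖h‖ / n) U (nhds 0) :=
    (tendsto_const_div_atTop_nhds_zero_nat _).mono_left hU
  have h2 : Tendsto (fun n => ∫ x, h (g x) ∂(μs n : Measure ℝ) - ∫ x, h x ∂(μs n : Measure ℝ)) U
      (nhds 0) := squeeze_zero_norm' (hinv.mono fun n hn => hn h) h0
  exact sub_eq_zero.1 (tendsto_nhds_unique h1 h2)

/-- Lower bound for the entropy plus energy of some invariant measure in terms of the exponential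
growth of the weighted preimages of a point. -/
theorem exists_invariant_le_partitionEntropy {g : ℝ → ℝ} (hg : Continuous g) {a b : ℝ}
    (hI : MapsTo g (Icc a b) (Icc a b)) {C : Finset ℝ} (hC : SeparatesFibers g (Icc a b) C)
    (φ : BoundedContinuousFunction ℝ ℝ) {x₀ : ℝ} (E : ℕ → Finset ℝ) (hEne : ∀ n, (E n).Nonempty)
    (hE : ∀ n y, y ∈ E n ↔ y ∈ Icc a b ∧ g^[n] y = x₀) {c : ℝ}
    (hc : ∃ᶠ n : ℕ in atTop, c < Real.log (∑ y ∈ E n, Real.exp (birkhoffSum g φ n y)) / n) :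
    ∃ μ : Measure ℝ, IsProbabilityMeasure μ ∧ μ (Icc a b)ᶜ = 0 ∧ μ.map g = μ ∧
      ∀ m : ℕ, 0 < m → ∃ (K : ℕ) (p : ℝ → Fin K), Measurable p ∧ ∀ n : ℕ,
        c - Real.log 2 / m - ∫ x, φ x ∂μ
          ≤ partitionEntropy μ (itinerary g p 0 (n + 1)) / (n + 1) := by
  choose! μs hμp hμI hμinv hμent using fun n (hn : 0 < n) =>
    exists_orbit_average hg measurableSet_Icc hI φ (E n) (hEne n)
      (fun y hy => ((hE n y).1 hy).1) hn
  set F : Filter ℕ := atTop ⊓ 𝓟 {n : ℕ | 0 < n ∧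
    c < Real.log (∑ y ∈ E n, Real.exp (birkhoffSum g φ n y)) / n} with hF
  have : F.NeBot := by
    rw [hF, ← frequently_mem_iff_neBot]
    exact (hc.and_eventually (eventually_gt_atTop 0)).mono fun n hn => ⟨hn.2, hn.1⟩
  set U : Ultrafilter ℕ := Ultrafilter.of F
  have hUF : (U : Filter ℕ) ≤ F := Ultrafilter.of_le F
  have hU : (U : Filter ℕ) ≤ atTop := hUF.trans inf_le_left
  have hUs : ∀ᶠ n : ℕ in (U : Filter ℕ), 0 < n ∧
      c < Real.log (∑ y ∈ E n, Real.exp (birkhoffSum g φ n y)) / n :=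
    hUF (mem_inf_of_right (mem_principal_self _))
  let νs : ℕ → ProbabilityMeasure ℝ := fun n =>
    if hn : 0 < n then ⟨μs n, hμp n hn⟩ else ⟨Measure.dirac 0, inferInstance⟩
  have hν : ∀ n, 0 < n → (νs n : Measure ℝ) = μs n := fun n hn => by simp [νs, hn]
  obtain ⟨μ, hμ0, hμg, hlim⟩ := exists_invariant_tendsto hg hU (μs := νs) (a := a) (b := b)
    (hUs.mono fun n hn => by rw [hν n hn.1]; exact hμI n hn.1)
    (hUs.mono fun n hn => by rw [hν n hn.1]; exact hμinv n hn.1)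
  refine ⟨μ, inferInstance, hμ0, hμg, fun m hm => ?_⟩
  obtain ⟨D, hD⟩ := hC.exists_iterate hg hI m
  obtain ⟨K, p, hpm, hpf, hps⟩ := exists_partition_null_frontier (μ : Measure ℝ) D
  refine ⟨K, p, hpm, fun k => ?_⟩
  set N := C.card + 1 with hN
  have hN1 : 1 ≤ N := by omega
  have hfib := hC.encard_fiber_le
  have hcount := encard_fiber_itinerary_le hI hN1 hfib hm (hD.encard_le_two hps)
  have hint := ProbabilityMeasure.tendsto_iff_forall_integral_tendsto.1 hlim φ
  have hent := tendsto_partitionEntropy hlim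
    (q := itinerary g p 0 (k + 1)) (measure_frontier_itinerary hg hμg hpf (k + 1))
  set r : ℝ := (k : ℝ) + 1 with hr
  have hr0 : 0 < r := by positivity
  have hm0 : (0 : ℝ) < m := by exact_mod_cast hm
  have hzero : Tendsto (fun n : ℕ => (r * (m * Real.log N) + 2 * (r * (r * Real.log K))) / n)
      U (nhds 0) := (tendsto_const_div_atTop_nhds_zero_nat _).mono_left hU
  have key : r * c ≤ r * (Real.log 2 / m) + 0 + partitionEntropy (μ : Measure ℝ)
      (itinerary g p 0 (k + 1)) + r * ∫ x, φ x ∂(μ : Measure ℝ) := by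
    refine ge_of_tendsto (((tendsto_const_nhds.add hzero).add hent).add (hint.const_mul r)) ?_
    filter_upwards [hUs] with n hn
    obtain ⟨hn, hcn⟩ := hn
    have hn0 : (0 : ℝ) < n := by exact_mod_cast hn
    have hM1 : 1 ≤ N ^ m * 2 ^ (n / m) := Nat.one_le_iff_ne_zero.2 (by positivity)
    have h1 := hμent n hn K p (fun i => hpm (measurableSet_singleton i)) (k + 1)
      (N ^ m * 2 ^ (n / m)) (by positivity) (by exact_mod_cast hM1) (fun s => by
        refine le_trans (encard_le_encard ?_) (by exact_mod_cast hcount n x₀ s)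
        rintro y ⟨hy, hys⟩
        have := (hE n y).1 hy
        exact ⟨this.1, this.2, hys⟩)
    rw [← hν n hn] at h1
    have hlogM : Real.log ((N ^ m * 2 ^ (n / m) : ℕ) : ℝ) ≤ m * Real.log N + n / m * Real.log 2 := by
      push_cast
      rw [Real.log_mul (by positivity) (by positivity), Real.log_pow, Real.log_pow]
      have : ((n / m : ℕ) : ℝ) ≤ n / m := Nat.cast_div_le
      have h2 : 0 ≤ Real.log 2 := Real.log_nonneg (by norm_num)
      gcongr
    rw [lt_div_iff₀ hn0] at hcn
    push_cast at h1 hlogM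
    rw [← hr] at h1
    have h3 : r * c * n ≤ (r * (Real.log 2 / m) + (r * (m * Real.log N) +
        2 * (r * (r * Real.log K))) / n + partitionEntropy (νs n : Measure ℝ)
        (itinerary g p 0 (k + 1)) + r * ∫ x, φ x ∂(νs n : Measure ℝ)) * n := by
      have e : (r * (Real.log 2 / m) + (r * (m * Real.log N) +
        2 * (r * (r * Real.log K))) / n + partitionEntropy (νs n : Measure ℝ)
        (itinerary g p 0 (k + 1)) + r * ∫ x, φ x ∂(νs n : Measure ℝ)) * n
        = r * (m * Real.log N + n / m * Real.log 2) + 2 * (r * (r * Real.log K)) +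
          n * partitionEntropy (νs n : Measure ℝ) (itinerary g p 0 (k + 1)) +
          r * (n * ∫ x, φ x ∂(νs n : Measure ℝ)) := by
        field_simp
        ring
      rw [e]
      have h4 := mul_le_mul_of_nonneg_left hlogM hr0.le
      have h5 := mul_le_mul_of_nonneg_left hcn.le hr0.le
      linarith
    exact le_of_mul_le_mul_right h3 hn0
  rw [le_div_iff₀ hr0]
  linarith

theorem iterate_eq_of_eqOn {f g : ℝ → ℝ} {I : Set ℝ} (hfg : EqOn f g I) (hI : MapsTo g I I)
    (n : ℕ) {x : ℝ} (hx : x ∈ I) : f^[n] x = g^[n] x := by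
  induction n with
  | zero => rfl
  | succ n ih =>
    rw [Function.iterate_succ_apply', Function.iterate_succ_apply', ih]
    exact hfg (hI.iterate n hx)

theorem invariantProb_iff {f g : ℝ → ℝ} (hg : Measurable g) {I : Set ℝ} (hIm : MeasurableSet I)
    (hfg : EqOn f g I) (μ : Measure ℝ) :
    InvariantProb f I μ ↔ IsProbabilityMeasure μ ∧ μ Iᶜ = 0 ∧ μ.map g = μ := by
  unfold InvariantProb
  refine and_congr_right fun hp => ?_
  rw [prob_compl_eq_zero_iff hIm]
  refine and_congr_right fun hI => ?_
  have hae : ∀ A : Set ℝ, μ (f ⁻¹' A) = μ (g ⁻¹' A) := fun A => by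
    refine measure_congr ?_
    filter_upwards [(mem_ae_iff_prob_eq_one hIm).2 hI] with x hx
    exact congrArg (· ∈ A) (hfg hx)
  constructor
  · intro h
    ext A hA
    rw [Measure.map_apply hg hA, ← hae, h A hA]
  · intro h A hA
    rw [hae, ← Measure.map_apply hg hA, h]

theorem partitionEntropy_orbit_eq {f g : ℝ → ℝ} {I : Set ℝ} (hfg : EqOn f g I)
    (hI : MapsTo g I I) {μ : Measure ℝ} (hμ : μ Iᶜ = 0) {k : ℕ} (p : ℝ → Fin k) (n : ℕ) :
    partitionEntropy μ (fun x (i : Fin n) => p (f^[(i : ℕ)] x))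
      = partitionEntropy μ (itinerary g p 0 n) := by
  refine partitionEntropy_congr fun s => measure_congr ?_
  filter_upwards [compl_mem_ae_iff.2 hμ] with x hx
  have hx : x ∈ I := by simpa using hx
  refine congrArg (· ∈ ({s} : Set (Fin n → Fin k))) (funext fun i => ?_)
  simp only [itinerary, zero_add]
  rw [iterate_eq_of_eqOn hfg hI i hx]

section KSEntropy

variable {f g : ℝ → ℝ} {a b : ℝ} {N : ℕ} {μ : Measure ℝ}

theorem iInf_partitionEntropy_orbit_le (hg : Continuous g) (hI : MapsTo g (Icc a b) (Icc a b))
    (hfg : EqOn f g (Icc a b)) (hN1 : 1 ≤ N)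
    (hN : ∀ z, {y ∈ Icc a b | g y = z}.encard ≤ N) (hμ : InvariantProb f (Icc a b) μ)
    {k : ℕ} {p : ℝ → Fin k} (hp : Measurable p) :
    ⨅ n : ℕ, partitionEntropy μ (fun x (i : Fin (n + 1)) => p (f^[(i : ℕ)] x)) / (n + 1)
      ≤ 2 * (1 + Real.log (2 * N)) + 3 := by
  obtain ⟨hμp, hμI, hμg⟩ := (invariantProb_iff hg.measurable measurableSet_Icc hfg μ).1 hμ
  simp_rw [partitionEntropy_orbit_eq hfg hI hμI]
  exact iInf_partitionEntropy_le hg hI hN1 hN μ hμI hμg hp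

theorem ksEntropy_bound_nonneg (hN1 : 1 ≤ N) : (0 : ℝ) ≤ 2 * (1 + Real.log (2 * N)) + 3 := by
  have : (1 : ℝ) ≤ N := by exact_mod_cast hN1
  have := Real.log_nonneg (show (1 : ℝ) ≤ 2 * N by linarith)
  linarith

theorem ksEntropy_le (hg : Continuous g) (hI : MapsTo g (Icc a b) (Icc a b))
    (hfg : EqOn f g (Icc a b)) (hN1 : 1 ≤ N)
    (hN : ∀ z, {y ∈ Icc a b | g y = z}.encard ≤ N) (hμ : InvariantProb f (Icc a b) μ) :
    ksEntropy μ f ≤ 2 * (1 + Real.log (2 * N)) + 3 :=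
  Real.iSup_le (fun _ => Real.iSup_le
    (fun p => iInf_partitionEntropy_orbit_le hg hI hfg hN1 hN hμ p.2)
    (ksEntropy_bound_nonneg hN1)) (ksEntropy_bound_nonneg hN1)

theorem le_ksEntropy (hg : Continuous g) (hI : MapsTo g (Icc a b) (Icc a b))
    (hfg : EqOn f g (Icc a b)) (hN1 : 1 ≤ N)
    (hN : ∀ z, {y ∈ Icc a b | g y = z}.encard ≤ N) (hμ : InvariantProb f (Icc a b) μ)
    {k : ℕ} {p : ℝ → Fin k} (hp : Measurable p) {c : ℝ}
    (hc : ∀ n : ℕ, c ≤ partitionEntropy μ (itinerary g p 0 (n + 1)) / (n + 1)) :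
    c ≤ ksEntropy μ f := by
  obtain ⟨hμp, hμI, hμg⟩ := (invariantProb_iff hg.measurable measurableSet_Icc hfg μ).1 hμ
  have h1 : c ≤ ⨅ n : ℕ, partitionEntropy μ
      (fun x (i : Fin (n + 1)) => p (f^[(i : ℕ)] x)) / (n + 1) :=
    le_ciInf fun n => by rw [partitionEntropy_orbit_eq hfg hI hμI]; exact hc n
  refine h1.trans (le_trans ?_ (le_ciSup (f := fun k : ℕ => ⨆ p : { p : ℝ → Fin k // Measurable p },
    ⨅ n : ℕ, partitionEntropy μ (fun x (i : Fin (n + 1)) => p.1 (f^[(i : ℕ)] x)) / (n + 1)) ?_ k))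
  · refine le_ciSup (f := fun p : { p : ℝ → Fin k // Measurable p } =>
      ⨅ n : ℕ, partitionEntropy μ (fun x (i : Fin (n + 1)) => p.1 (f^[(i : ℕ)] x)) / (n + 1))
      ?_ ⟨p, hp⟩
    exact ⟨_, forall_mem_range.2 fun p =>
      iInf_partitionEntropy_orbit_le hg hI hfg hN1 hN hμ p.2⟩
  · exact ⟨_, forall_mem_range.2 fun k => Real.iSup_le
      (fun p => iInf_partitionEntropy_orbit_le hg hI hfg hN1 hN hμ p.2)
      (ksEntropy_bound_nonneg hN1)⟩

end KSEntropy

theorem integral_eq_of_eqOn {φ ψ : ℝ → ℝ} {I : Set ℝ} (h : EqOn φ ψ I) {μ : Measure ℝ}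
    (hμ : μ Iᶜ = 0) : ∫ x, φ x ∂μ = ∫ x, ψ x ∂μ := by
  refine integral_congr_ae ?_
  filter_upwards [compl_mem_ae_iff.2 hμ] with x hx
  exact h (by simpa using hx)

theorem add_integral_le_pressure {f g : ℝ → ℝ} (hg : Continuous g) {a b : ℝ}
    (hI : MapsTo g (Icc a b) (Icc a b)) (hfg : EqOn f g (Icc a b)) {N : ℕ} (hN1 : 1 ≤ N)
    (hN : ∀ z, {y ∈ Icc a b | g y = z}.encard ≤ N) {φ : ℝ → ℝ}
    (ψ : BoundedContinuousFunction ℝ ℝ) (hφ : EqOn φ ψ (Icc a b)) {μ : Measure ℝ}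
    (hμ : InvariantProb f (Icc a b) μ) :
    ksEntropy μ f + ∫ x, ψ x ∂μ ≤ pressure f (Icc a b) φ := by
  have hμ' := (invariantProb_iff hg.measurable measurableSet_Icc hfg μ).1 hμ
  refine le_csSup ⟨2 * (1 + Real.log (2 * N)) + 3 + ‖ψ‖, ?_⟩
    ⟨μ, hμ, by rw [integral_eq_of_eqOn hφ hμ'.2.1]⟩
  rintro _ ⟨ν, hν, rfl⟩
  obtain ⟨hνp, hνI, -⟩ := (invariantProb_iff hg.measurable measurableSet_Icc hfg ν).1 hν
  rw [integral_eq_of_eqOn hφ hνI]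
  have := (le_abs_self _).trans (ψ.norm_integral_le_norm ν)
  exact add_le_add (ksEntropy_le hg hI hfg hN1 hN hν) this

/-- By Rolle's theorem the critical points separate the points of each fiber. -/
theorem separatesFibers_of_finite_critical {f : ℝ → ℝ} {a b : ℝ}
    (hd : ∀ x ∈ Icc a b, DifferentiableAt ℝ f x)
    (hfin : {x | x ∈ Icc a b ∧ deriv f x = 0}.Finite) :
    SeparatesFibers f (Icc a b) hfin.toFinset := by
  intro x hx y hy hxy h
  have hsub : Icc x y ⊆ Icc a b := Icc_subset_Icc hx.1 hy.2
  obtain ⟨c, hc, hc0⟩ := exists_deriv_eq_zero hxy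
    (fun z hz => (hd z (hsub hz)).continuousAt.continuousWithinAt) h
  exact ⟨c, hfin.mem_toFinset.2 ⟨hsub (Ioo_subset_Icc_self hc), hc0⟩, hc.1, hc.2⟩

theorem TopExact.surjOn {f : ℝ → ℝ} {I : Set ℝ} (hex : TopExact f I) (hI : MapsTo f I I)
    (hne : I.Nonempty) : SurjOn f I I := by
  obtain ⟨n, hn, h⟩ := hex univ isOpen_univ (by simpa using hne)
  rw [univ_inter] at h
  intro z hz
  rw [← h] at hz
  obtain ⟨y, hy, rfl⟩ := hz
  obtain ⟨k, rfl⟩ := Nat.exists_eq_add_of_le' hn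
  exact ⟨f^[k] y, hI.iterate k hy, (Function.iterate_succ_apply' f k y).symm⟩

theorem neg_norm_le_log_sum_div {g : ℝ → ℝ} (φ : BoundedContinuousFunction ℝ ℝ)
    {E : Finset ℝ} (hE : E.Nonempty) (n : ℕ) :
    -‖φ‖ ≤ Real.log (∑ y ∈ E, Real.exp (birkhoffSum g φ n y)) / n := by
  rcases Nat.eq_zero_or_pos n with rfl | hn
  · simp
  have hn0 : (0 : ℝ) < n := by exact_mod_cast hn
  obtain ⟨y, hy⟩ := hE
  rw [le_div_iff₀ hn0, Real.le_log_iff_exp_le (Finset.sum_pos (fun _ _ => Real.exp_pos _) ⟨y, hy⟩)]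
  refine le_trans (Real.exp_le_exp.2 ?_)
    (Finset.single_le_sum (f := fun y => Real.exp (birkhoffSum g φ n y))
      (fun _ _ => (Real.exp_pos _).le) hy)
  have : ∑ _k ∈ Finset.range n, -‖φ‖ ≤ birkhoffSum g φ n y :=
    Finset.sum_le_sum fun k _ => neg_le_of_abs_le (φ.norm_coe_le_norm _)
  simp only [Finset.sum_const, Finset.card_range, nsmul_eq_mul] at this
  linarith

theorem limsup_log_sum_le_pressure {f g : ℝ → ℝ} (hg : Continuous g) {a b : ℝ}
    (hI : MapsTo g (Icc a b) (Icc a b)) (hfg : EqOn f g (Icc a b)) {C : Finset ℝ}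
    (hC : SeparatesFibers g (Icc a b) C) {φ : ℝ → ℝ} (ψ : BoundedContinuousFunction ℝ ℝ)
    (hφ : EqOn φ ψ (Icc a b)) {x₀ : ℝ} (E : ℕ → Finset ℝ) (hEne : ∀ n, (E n).Nonempty)
    (hE : ∀ n y, y ∈ E n ↔ y ∈ Icc a b ∧ g^[n] y = x₀) :
    atTop.limsup (fun n : ℕ => Real.log (∑ y ∈ E n, Real.exp (birkhoffSum g ψ n y)) / n)
      ≤ pressure f (Icc a b) φ := by
  by_contra! hlt
  obtain ⟨c, hPc, hcl⟩ := exists_between hlt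
  have hfreq := frequently_lt_of_lt_limsup
    (IsBoundedUnder.isCoboundedUnder_le
      (isBoundedUnder_of ⟨-‖ψ‖, fun n => neg_norm_le_log_sum_div ψ (hEne n) n⟩)) hcl
  obtain ⟨μ, hμp, hμI, hμg, hμ⟩ :=
    exists_invariant_le_partitionEntropy hg hI hC ψ E hEne hE hfreq
  have hμinv := (invariantProb_iff hg.measurable measurableSet_Icc hfg μ).2 ⟨hμp, hμI, hμg⟩
  have hN1 : 1 ≤ C.card + 1 := by omega
  have hle := add_integral_le_pressure hg hI hfg hN1 hC.encard_fiber_le ψ hφ hμinv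
  have hks : ∀ m : ℕ, 0 < m → c - Real.log 2 / m ≤ pressure f (Icc a b) φ := fun m hm => by
    obtain ⟨K, p, hp, h⟩ := hμ m hm
    have := le_ksEntropy hg hI hfg hN1 hC.encard_fiber_le hμinv hp h
    linarith
  have hlim : Tendsto (fun m : ℕ => c - Real.log 2 / m) atTop (nhds (c - 0)) :=
    tendsto_const_nhds.sub (tendsto_const_div_atTop_nhds_zero_nat _)
  rw [sub_zero] at hlim
  exact hPc.not_ge (le_of_tendsto hlim ((eventually_gt_atTop 0).mono hks))

/-- **Lemma (tree pressure bound).** For a topologically exact `C³` interval map with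
non-flat critical points and a continuous `φ`, for every `x₀ ∈ I`,
`P(f, φ) ≥ limsup (1/n) log Σ_{y ∈ f^{-n}(x₀)} exp(Sₙ(φ)(y))`. -/
theorem tree_pressure_le_pressure
    (a b : ℝ) (f : ℝ → ℝ)
    (hf : IsC3NonflatIntervalMap f a b)
    (hex : TopExact f (Icc a b))
    (φ : ℝ → ℝ) (hφ : ContinuousOn φ (Icc a b)) :
    ∀ x₀ ∈ Icc a b,
      atTop.limsup (fun n : ℕ => Real.log (preimSum f φ (Icc a b) n x₀) / n)
        ≤ pressure f (Icc a b) φ := by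
  intro x₀ hx₀
  have hab : a ≤ b := hf.lt.le
  have hfc : ContinuousOn f (Icc a b) := fun x hx => (hf.diff x hx).continuousAt.continuousWithinAt
  let g : ℝ → ℝ := IccExtend hab ((Icc a b).domRestrict f)
  have hg : Continuous g := (continuousOn_iff_continuous_domRestrict.1 hfc).Icc_extend'
  have hfg : EqOn f g (Icc a b) := fun x hx =>
    (IccExtend_of_mem hab ((Icc a b).domRestrict f) hx).symm
  have hI : MapsTo g (Icc a b) (Icc a b) := hf.mapsTo.congr hfg
  have hsep : SeparatesFibers g (Icc a b) hf.critFinite.toFinset := fun x hx y hy hxy h =>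
    separatesFibers_of_finite_critical hf.diff hf.critFinite x hx y hy hxy
      (by rw [hfg hx, hfg hy, h])
  have hφ' : Continuous (IccExtend hab ((Icc a b).domRestrict φ)) :=
    (continuousOn_iff_continuous_domRestrict.1 hφ).Icc_extend'
  obtain ⟨B, hB⟩ := isCompact_Icc.exists_bound_of_continuousOn hφ
  let ψ : BoundedContinuousFunction ℝ ℝ :=
    BoundedContinuousFunction.ofNormedAddCommGroup _ hφ' B
      fun x => hB _ (projIcc a b hab x).2
  have hψ : EqOn φ ψ (Icc a b) := fun x hx =>
    (IccExtend_of_mem hab ((Icc a b).domRestrict φ) hx).symm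
  have hfin : ∀ n, {y ∈ Icc a b | g^[n] y = x₀}.Finite := fun n =>
    Set.encard_lt_top_iff.1 (lt_of_le_of_lt
      (encard_fiber_iterate_le hI hsep.encard_fiber_le n x₀) (ENat.natCast_lt_top _))
  have hsurj : SurjOn g (Icc a b) (Icc a b) :=
    (hex.surjOn hf.mapsTo ⟨x₀, hx₀⟩).congr hfg
  have hsum : ∀ n, preimSum f φ (Icc a b) n x₀
      = ∑ y ∈ (hfin n).toFinset, Real.exp (birkhoffSum g ψ n y) := fun n => by
    rw [← finsum_mem_eq_finite_toFinset_sum, preimSum]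
    refine finsum_mem_congr (Set.ext fun y => and_congr_right fun hy => ?_) fun y hy => ?_
    · rw [iterate_eq_of_eqOn hfg hI n hy]
    · refine congrArg Real.exp (Finset.sum_congr rfl fun k _ => ?_)
      rw [iterate_eq_of_eqOn hfg hI k hy.1]
      exact hψ (hI.iterate k hy.1)
  simp_rw [hsum]
  refine limsup_log_sum_le_pressure (x₀ := x₀) hg hI hfg hsep ψ hψ (fun n => (hfin n).toFinset)
    (fun n => ?_) (fun n y => (hfin n).mem_toFinset)
  obtain ⟨y, hy, hyx⟩ := hsurj.iterate n hx₀
  exact ⟨y, (hfin n).mem_toFinset.2 ⟨hy, hyx⟩⟩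

end
end

section
/- Let (X, d) be a compact metric space, T: X → X a continuous map, and φ: X → ℝ a continuous function. Then limsup_{n→∞} sup_{x ∈ X} (1/n) S_n(φ)(x) ≤ sup{ ∫_X φ dν : ν a T-invariant Borel probability measure on X }. -/
open MeasureTheory Filter Set

noncomputable section

open Topology BoundedContinuousFunction

/-- The average of finitely many point masses along an orbit is a probability measure whose
integrals are Birkhoff averages. -/
theorem exists_probabilityMeasure_integral_eq_birkhoffAverage
    {X : Type*} [TopologicalSpace X] [MeasurableSpace X] [OpensMeasurableSpace X]
    (T : X → X) (x : X) {n : ℕ} (hn : n ≠ 0) :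
    ∃ P : ProbabilityMeasure X, ∀ f : X →ᵇ ℝ,
      ∫ y, f y ∂(P : Measure X) = birkhoffAverage ℝ T f n x := by
  refine ⟨⟨(n : ENNReal)⁻¹ • ∑ k ∈ Finset.range n, Measure.dirac (T^[k] x), ⟨?_⟩⟩, fun f ↦ ?_⟩
  · simp [ENNReal.inv_mul_cancel, hn]
  · have hf : StronglyMeasurable f :=
      f.continuous.measurable.stronglyMeasurable
    simp only [ProbabilityMeasure.coe_mk, integral_smul_measure, ENNReal.toReal_inv,
      ENNReal.toReal_natCast, birkhoffAverage, birkhoffSum]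
    rw [integral_finsetSum_measure fun k _ ↦ f.integrable _]
    simp only [integral_dirac' _ _ hf]

theorem birkhoffAverage_comp_self {X : Type*} (T : X → X) (f : X → ℝ) (n : ℕ) (x : X) :
    birkhoffAverage ℝ T (f ∘ T) n x = birkhoffAverage ℝ T f n (T x) := by
  simp only [birkhoffAverage, birkhoffSum, Function.comp_apply,
    (Function.Commute.iterate_self T _).eq]

/-- **Krylov–Bogolyubov**: a weak limit of empirical measures is invariant. -/
theorem map_eq_of_tendsto_of_integral_eq_birkhoffAverage
    {X : Type*} [TopologicalSpace X] [MeasurableSpace X] [BorelSpace X] [HasOuterApproxClosed X]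
    {T : X → X} (hT : Continuous T) {x : ℕ → X} {P : ℕ → ProbabilityMeasure X}
    {l : Filter ℕ} [l.NeBot] (hl : l ≤ atTop)
    (hP : ∀ᶠ n in l, ∀ f : X →ᵇ ℝ,
      ∫ y, f y ∂(P n : Measure X) = birkhoffAverage ℝ T f n (x n))
    {μ : ProbabilityMeasure X} (hμ : Tendsto P l (𝓝 μ)) :
    (μ : Measure X).map T = μ := by
  have : IsProbabilityMeasure ((μ : Measure X).map T) :=
    Measure.isProbabilityMeasure_map hT.aemeasurable
  refine ext_of_forall_integral_eq_of_IsFiniteMeasure fun f ↦ ?_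
  rw [integral_map hT.aemeasurable f.continuous.measurable.aestronglyMeasurable]
  rw [ProbabilityMeasure.tendsto_iff_forall_integral_tendsto] at hμ
  let g : X →ᵇ ℝ := f.compContinuous ⟨T, hT⟩
  have hlim := (hμ g).sub (hμ f)
  have hzero : Tendsto (fun n ↦ ∫ y, g y ∂(P n : Measure X) - ∫ y, f y ∂(P n : Measure X))
      l (𝓝 0) := by
    have hC : Tendsto (fun n : ℕ ↦ 2 * ‖f‖ / n) l (𝓝 0) :=
      (tendsto_const_nhds.div_atTop tendsto_natCast_atTop_atTop).mono_left hl
    refine squeeze_zero_norm' (hP.mono fun n hn ↦ ?_) hC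
    have hg : ⇑g = f ∘ T := rfl
    rw [hn, hn, hg, birkhoffAverage_comp_self, ← dist_eq_norm,
      dist_birkhoffAverage_apply_birkhoffAverage]
    gcongr
    exact f.dist_le_two_norm _ _
  exact sub_eq_zero.1 (tendsto_nhds_unique hlim hzero)

/-- **Lemma.** For a continuous self-map `T` of a compact metric space `X` and a
continuous `φ : X → ℝ`,
`limsup_n sup_X (1/n) Sₙ(φ) ≤ sup { ∫ φ dν : ν a T-invariant Borel probability measure }`. -/
theorem limsup_sup_birkhoff_le_sup_integral
    (X : Type*) [MetricSpace X] [CompactSpace X] [Nonempty X]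
    [MeasurableSpace X] [BorelSpace X]
    (T : X → X) (hT : Continuous T)
    (φ : X → ℝ) (hφ : Continuous φ) :
    atTop.limsup (fun n : ℕ => (⨆ x : X, birkhoffSum T φ n x) / n) ≤
      sSup { r : ℝ | ∃ μ : Measure X, IsProbabilityMeasure μ ∧
        (∀ A : Set X, MeasurableSet A → μ (T ⁻¹' A) = μ A) ∧ r = ∫ x, φ x ∂μ } := by
  set S := { r : ℝ | ∃ μ : Measure X, IsProbabilityMeasure μ ∧
    (∀ A : Set X, MeasurableSet A → μ (T ⁻¹' A) = μ A) ∧ r = ∫ x, φ x ∂μ }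
  let Φ : X →ᵇ ℝ := BoundedContinuousFunction.mkOfCompact ⟨φ, hφ⟩
  have hbdd : BddAbove S := by
    refine ⟨‖Φ‖, ?_⟩
    rintro r ⟨μ, hμ, -, rfl⟩
    exact (le_abs_self _).trans (Φ.norm_integral_le_norm μ)
  have hmax (n : ℕ) : ∃ x, (⨆ y, birkhoffSum T φ n y) = birkhoffSum T φ n x := by
    have hcont : Continuous (birkhoffSum T φ n) :=
      continuous_finsetSum _ fun k _ ↦ hφ.comp (hT.iterate k)
    obtain ⟨x, -, hx⟩ := isCompact_univ.exists_isMaxOn univ_nonempty hcont.continuousOn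
    exact ⟨x, le_antisymm (ciSup_le fun y ↦ hx (mem_univ y))
      (le_ciSup (isCompact_range hcont).bddAbove x)⟩
  choose x hx using hmax
  have hP (n : ℕ) : ∃ P : ProbabilityMeasure X, n ≠ 0 → ∀ f : X →ᵇ ℝ,
      ∫ y, f y ∂(P : Measure X) = birkhoffAverage ℝ T f n (x n) := by
    rcases eq_or_ne n 0 with rfl | hn
    · exact ⟨⟨Measure.dirac (x 0), inferInstance⟩, fun h ↦ (h rfl).elim⟩
    · obtain ⟨P, hP⟩ := exists_probabilityMeasure_integral_eq_birkhoffAverage T (x n) hn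
      exact ⟨P, fun _ ↦ hP⟩
  choose P hP using hP
  have hu : ∀ n : ℕ, n ≠ 0 →
      (⨆ y, birkhoffSum T φ n y) / n = ∫ y, Φ y ∂(P n : Measure X) := by
    intro n hn
    rw [hP n hn, hx, birkhoffAverage, smul_eq_mul, div_eq_inv_mul]
    rfl
  have hne : ∀ᶠ n : ℕ in atTop, n ≠ 0 := eventually_ne_atTop 0
  have hcobdd : IsCoboundedUnder (· ≤ ·) atTop
      (fun n : ℕ ↦ (⨆ y, birkhoffSum T φ n y) / n) := by
    refine IsBoundedUnder.isCoboundedUnder_le ⟨-‖Φ‖, eventually_map.2 (hne.mono fun n hn ↦ ?_)⟩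
    rw [hu n hn]
    exact (abs_le.1 (Φ.norm_integral_le_norm (P n : Measure X))).1
  refine le_of_forall_lt_imp_le_of_dense fun c hc ↦ ?_
  have hfreq := frequently_lt_of_lt_limsup hcobdd hc
  have : (atTop ⊓ 𝓟 {n : ℕ | c < (⨆ y, birkhoffSum T φ n y) / n}).NeBot :=
    frequently_mem_iff_neBot.1 hfreq
  let U : Ultrafilter ℕ := Ultrafilter.of (atTop ⊓ 𝓟 {n | c < (⨆ y, birkhoffSum T φ n y) / n})
  have hU := Ultrafilter.of_le (atTop ⊓ 𝓟 {n : ℕ | c < (⨆ y, birkhoffSum T φ n y) / n})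
  have hUtop : (U : Filter ℕ) ≤ atTop := hU.trans inf_le_left
  have hUc : ∀ᶠ n in (U : Filter ℕ), c < (⨆ y, birkhoffSum T φ n y) / n :=
    (hU.trans inf_le_right) (mem_principal_self _)
  obtain ⟨μ, -, hμ⟩ := isCompact_univ.ultrafilter_le_nhds (U.map P) (by simp)
  have hμ : Tendsto P U (𝓝 μ) := hμ
  have hinv := map_eq_of_tendsto_of_integral_eq_birkhoffAverage hT hUtop
    ((hne.filter_mono hUtop).mono hP) hμ
  have hcμ : c ≤ ∫ y, Φ y ∂(μ : Measure X) := by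
    refine ge_of_tendsto (ProbabilityMeasure.tendsto_iff_forall_integral_tendsto.1 hμ Φ) ?_
    filter_upwards [hUc, hne.filter_mono hUtop] with n hn hn0
    exact (hn.trans_eq (hu n hn0)).le
  refine hcμ.trans (le_csSup hbdd ⟨μ, inferInstance, fun A hA ↦ ?_, rfl⟩)
  rw [← Measure.map_apply hT.measurable hA, hinv]

end
end
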